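/- arXiv:1011.4216 — 2 statements merged into one kernel-verified Lean document; each statement's English description precedes it below -/
import Mathlib

section
/- Let M be a finite a-digraph. Then M is set-homogeneous if and only if M is isomorphic to one of the following: D_1, D_3, D_4, D_5, H_0, K̄_n, K̄_n[D_3], or D_3[K̄_n], for some integer n ≥ 1. -/
/-- An a-digraph structure: a binary arc relation on the vertex type. -/
structure ADigraph (V : Type*) where
  arc : V → V → Prop

namespace ADigraph

variable {V W : Type*}

/-- The a-digraph axioms: the arc relation is irreflexive and antisymmetric
(no loops, and never arcs in both directions between two vertices). -/
def IsA (M : ADigraph V) : Prop :=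
  (∀ v, ¬ M.arc v v) ∧ ∀ u v, M.arc u v → ¬ M.arc v u

/-- Isomorphism of a-digraphs. -/
def Iso (M : ADigraph V) (N : ADigraph W) : Prop :=
  ∃ e : V ≃ W, ∀ u v, M.arc u v ↔ N.arc (e u) (e v)

/-- Induced subdigraph on a set of vertices. -/
def induce (M : ADigraph V) (S : Set V) : ADigraph S :=
  ⟨fun u v => M.arc (u : V) (v : V)⟩

/-- `g` is an automorphism of `M`. -/
def IsAuto (M : ADigraph V) (g : V ≃ V) : Prop :=
  ∀ u v, M.arc u v ↔ M.arc (g u) (g v)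

/-- `M` is set-homogeneous: whenever two finite sets of vertices induce
isomorphic subdigraphs, some automorphism maps one set onto the other. -/
def SetHomogeneous (M : ADigraph V) : Prop :=
  ∀ U U' : Set V, U.Finite → U'.Finite → (M.induce U).Iso (M.induce U') →
    ∃ g : V ≃ V, M.IsAuto g ∧ ⇑g '' U = U'

/-- `M` is homogeneous: every isomorphism between finite induced subdigraphs
extends to an automorphism. -/
def Homogeneous (M : ADigraph V) : Prop :=
  ∀ U U' : Set V, U.Finite → U'.Finite → ∀ e : U ≃ U',
    (∀ u v : U, M.arc (u : V) (v : V) ↔ M.arc (e u : V) (e v : V)) →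
    ∃ g : V ≃ V, M.IsAuto g ∧ ∀ u : U, g (u : V) = (e u : V)

/-- `M` is `k`-homogeneous: every isomorphism between induced subdigraphs of
size `k` extends to an automorphism. -/
def KHomogeneous (M : ADigraph V) (k : ℕ) : Prop :=
  ∀ U U' : Set V, U.Finite → U'.Finite → U.ncard = k → U'.ncard = k →
    ∀ e : U ≃ U',
      (∀ u v : U, M.arc (u : V) (v : V) ↔ M.arc (e u : V) (e v : V)) →
      ∃ g : V ≃ V, M.IsAuto g ∧ ∀ u : U, g (u : V) = (e u : V)

/-- The directed `n`-cycle `D_n`: vertices `ZMod n`, arcs `i → i + 1`.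
(For `n = 1` this is a single vertex with no arcs.) -/
def dirCycle (n : ℕ) : ADigraph (ZMod n) :=
  ⟨fun i j => j = i + 1 ∧ i ≠ j⟩

/-- `K̄_n`: the a-digraph on `n` vertices with no arcs. -/
def kbar (n : ℕ) : ADigraph (Fin n) :=
  ⟨fun _ _ => False⟩

/-- The a-digraph with no arcs on an arbitrary vertex type. -/
def kbarOn (N : Type*) : ADigraph N :=
  ⟨fun _ _ => False⟩

/-- The compositional product `M[N]`. -/
def comp (M : ADigraph V) (N : ADigraph W) : ADigraph (V × W) :=
  ⟨fun p q => M.arc p.1 q.1 ∨ (p.1 = q.1 ∧ N.arc p.2 q.2)⟩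

/-- `M` is connected: any two vertices are joined by a path of arcs,
ignoring orientation. -/
def Connected (M : ADigraph V) : Prop :=
  ∀ u v : V, Relation.ReflTransGen (fun a b => M.arc a b ∨ M.arc b a) u v

/-- `H₀`: vertices the 8 nonzero vectors of `GF(3)²`, with an arc `u → v` iff
the determinant of the `2 × 2` matrix with columns `u`, `v` equals `1`. -/
def H0 : ADigraph {v : Fin 2 → ZMod 3 // v ≠ 0} :=
  ⟨fun u v => u.1 0 * v.1 1 - u.1 1 * v.1 0 = 1⟩

end ADigraph

namespace ADigraph

section Basic

variable {V W X : Type*}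

theorem Iso.symm {M : ADigraph V} {N : ADigraph W} : M.Iso N → N.Iso M := by
  rintro ⟨e, he⟩
  exact ⟨e.symm, fun u v => by simp [he]⟩

theorem Iso.trans {M : ADigraph V} {N : ADigraph W} {P : ADigraph X} :
    M.Iso N → N.Iso P → M.Iso P := by
  rintro ⟨e, he⟩ ⟨f, hf⟩
  exact ⟨e.trans f, fun u v => (he u v).trans (hf _ _)⟩

theorem SetHomogeneous.exists_auto {M : ADigraph V} (h : M.SetHomogeneous) {ι : Type*} [Finite ι]
    {p q : ι → V} (hp : p.Injective) (hq : q.Injective)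
    (hpq : ∀ i j, M.arc (p i) (p j) ↔ M.arc (q i) (q j)) :
    ∃ g : V ≃ V, M.IsAuto g ∧ g '' Set.range p = Set.range q := by
  refine h _ _ (Set.finite_range p) (Set.finite_range q)
    ⟨(Equiv.ofInjective p hp).symm.trans (Equiv.ofInjective q hq), ?_⟩
  rintro ⟨_, i, rfl⟩ ⟨_, j, rfl⟩
  simpa [induce, Equiv.ofInjective_symm_apply] using hpq i j

theorem SetHomogeneous.of_iso {M : ADigraph V} {N : ADigraph W} (h : N.SetHomogeneous)
    (hMN : M.Iso N) : M.SetHomogeneous := by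
  obtain ⟨e, he⟩ := hMN
  rintro U U' hU - ⟨φ, hφ⟩
  have := hU.to_subtype
  obtain ⟨g, hg, hgU⟩ := h.exists_auto (p := fun u : U => e u) (q := fun u : U => e (φ u))
    (e.injective.comp Subtype.val_injective)
    (e.injective.comp (Subtype.val_injective.comp φ.injective))
    (fun i j => by rw [← he, ← he]; exact hφ i j)
  refine ⟨e.trans (g.trans e.symm), fun u v => by simp [he, ← hg _ _], ?_⟩
  have h1 : Set.range (fun u : U => e u) = e '' U := by ext; simp [-Set.mem_image_equiv]
  have h2 : Set.range (fun u : U => e (φ u)) = e '' U' := by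
    ext x
    constructor
    · rintro ⟨u, rfl⟩
      exact ⟨_, (φ u).2, rfl⟩
    · rintro ⟨y, hy, rfl⟩
      exact ⟨φ.symm ⟨y, hy⟩, by simp⟩
  rw [h1, h2] at hgU
  have : ⇑(e.trans (g.trans e.symm)) = e.symm ∘ g ∘ e := rfl
  rw [this, Set.image_comp, Set.image_comp, hgU, ← Set.image_comp]
  simp

theorem Homogeneous.setHomogeneous {M : ADigraph V} (h : M.Homogeneous) : M.SetHomogeneous := by
  rintro U U' hU hU' ⟨e, he⟩
  obtain ⟨g, hg, hge⟩ := h U U' hU hU' e he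
  refine ⟨g, hg, ?_⟩
  ext x
  constructor
  · rintro ⟨u, hu, rfl⟩
    exact hge ⟨u, hu⟩ ▸ (e ⟨u, hu⟩).2
  · intro hx
    exact ⟨_, (e.symm ⟨x, hx⟩).2, by rw [hge]; simp⟩

/-- If the subsets of a directed cycle are determined up to rotation by their numbers of vertices
and arcs, then the cycle is set-homogeneous. -/
theorem setHomogeneous_dirCycle_of_counts (n : ℕ) [NeZero n]
    (h : ∀ U U' : Finset (ZMod n), U.card = U'.card →
      ((U ×ˢ U).filter fun p => p.2 = p.1 + 1 ∧ p.1 ≠ p.2).card =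
        ((U' ×ˢ U').filter fun p => p.2 = p.1 + 1 ∧ p.1 ≠ p.2).card →
      ∃ r, U.image (· + r) = U') :
    (dirCycle n).SetHomogeneous := by
  classical
  rintro U U' - - ⟨e, he⟩
  change ∀ u v : U, ((v : ZMod n) = u + 1 ∧ (u : ZMod n) ≠ v) ↔
    ((e v : ZMod n) = e u + 1 ∧ (e u : ZMod n) ≠ e v) at he
  obtain ⟨r, hr⟩ := h U.toFinset U'.toFinset
    (Finset.card_bij (fun u hu => (e ⟨u, by simpa using hu⟩ : ZMod n)) (by simp)
      (by simp [Subtype.val_inj])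
      (fun b hb => ⟨e.symm ⟨b, by simpa using hb⟩, by simp⟩))
    (Finset.card_bij (fun p hp => ((e ⟨p.1, by simp at hp; tauto⟩ : ZMod n),
        (e ⟨p.2, by simp at hp; tauto⟩ : ZMod n)))
      (by
        rintro ⟨a, b⟩ hp
        simp only [Finset.mem_filter, Finset.mem_product, Set.mem_toFinset] at hp
        simpa using (he ⟨a, hp.1.1⟩ ⟨b, hp.1.2⟩).1 hp.2)
      (by
        rintro ⟨a, b⟩ hp ⟨c, d⟩ hq
        simp [Subtype.val_inj])
      (by
        rintro ⟨a, b⟩ hp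
        simp only [Finset.mem_filter, Finset.mem_product, Set.mem_toFinset] at hp
        refine ⟨(e.symm ⟨a, hp.1.1⟩, e.symm ⟨b, hp.1.2⟩), ?_, by simp⟩
        have := (he (e.symm ⟨a, hp.1.1⟩) (e.symm ⟨b, hp.1.2⟩)).2 (by simpa using hp.2)
        simpa using this))
  refine ⟨Equiv.addRight r, fun u v => ?_, ?_⟩
  · simp only [dirCycle, Equiv.coe_addRight, add_right_comm u r 1, add_left_inj, ne_eq]
  · have := congrArg (fun s : Finset (ZMod n) => (s : Set (ZMod n))) hr
    simpa using this

theorem setHomogeneous_dirCycle_one : (dirCycle 1).SetHomogeneous :=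
  setHomogeneous_dirCycle_of_counts 1 (by decide +kernel)

theorem setHomogeneous_dirCycle_three : (dirCycle 3).SetHomogeneous :=
  setHomogeneous_dirCycle_of_counts 3 (by decide +kernel)

theorem setHomogeneous_dirCycle_four : (dirCycle 4).SetHomogeneous :=
  setHomogeneous_dirCycle_of_counts 4 (by decide +kernel)

theorem setHomogeneous_dirCycle_five : (dirCycle 5).SetHomogeneous :=
  setHomogeneous_dirCycle_of_counts 5 (by decide +kernel)

theorem exists_perm_extending [Finite V] (s : Set V) (f : V → V) (hf : Set.InjOn f s) :
    ∃ σ : V ≃ V, ∀ x ∈ s, σ x = f x := by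
  classical
  have := Fintype.ofFinite V
  obtain ⟨g, hg⟩ := Finset.exists_equiv_extend_of_card_eq (t := (Finset.univ : Finset V))
    Finset.card_univ.symm (s := s.toFinset) (f := f) (by simp) (by simpa using hf)
  exact ⟨g.trans (Equiv.subtypeUnivEquiv (by simp)), fun x hx => hg x (by simpa using hx)⟩

theorem homogeneous_kbar (n : ℕ) : (kbar n).Homogeneous := by
  classical
  intro U U' _ _ e _
  obtain ⟨σ, hσ⟩ := exists_perm_extending U (fun x => if h : x ∈ U then (e ⟨x, h⟩ : Fin n) else x)
    (fun x hx y hy h => by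
      simp only [hx, hy, dif_pos] at h
      simpa [Subtype.val_inj] using h)
  exact ⟨σ, fun u v => Iff.rfl, fun u => by simpa using hσ u u.2⟩

/-- The reverse a-digraph. -/
def rev (M : ADigraph V) : ADigraph V :=
  ⟨fun u v => M.arc v u⟩

theorem IsA.rev {M : ADigraph V} (hM : M.IsA) : M.rev.IsA :=
  ⟨hM.1, fun u v => hM.2 v u⟩

theorem IsA.induce {M : ADigraph V} (hM : M.IsA) (S : Set V) : (M.induce S).IsA :=
  ⟨fun v => hM.1 v, fun u v => hM.2 u v⟩

theorem IsA.ne {M : ADigraph V} (hM : M.IsA) {u v : V} (h : M.arc u v) : u ≠ v := by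
  rintro rfl
  exact hM.1 _ h

theorem SetHomogeneous.rev {M : ADigraph V} (hS : M.SetHomogeneous) : M.rev.SetHomogeneous := by
  rintro U U' hU hU' ⟨e, he⟩
  obtain ⟨g, hg, h⟩ := hS U U' hU hU' ⟨e, fun u v => he v u⟩
  exact ⟨g, fun u v => hg v u, h⟩

theorem SetHomogeneous.exists_auto_vertex {M : ADigraph V} (hM : M.IsA) (hS : M.SetHomogeneous)
    (u v : V) : ∃ g : V ≃ V, M.IsAuto g ∧ g u = v := by
  obtain ⟨g, hg, h⟩ := hS.exists_auto (p := fun _ : Unit => u) (q := fun _ => v)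
    (Function.injective_of_subsingleton _) (Function.injective_of_subsingleton _)
    (fun _ _ => by simp [hM.1])
  exact ⟨g, hg, by simpa using h⟩

theorem SetHomogeneous.exists_auto_pair {M : ADigraph V} (hM : M.IsA) (hS : M.SetHomogeneous)
    {u v u' v' : V} (huv : u ≠ v) (huv' : u' ≠ v') (h1 : M.arc u v ↔ M.arc u' v')
    (h2 : M.arc v u ↔ M.arc v' u') :
    ∃ g : V ≃ V, M.IsAuto g ∧ ((g u = u' ∧ g v = v') ∨ (g u = v' ∧ g v = u')) := by
  obtain ⟨g, hg, h⟩ := hS.exists_auto (p := fun i : Bool => cond i v u)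
    (q := fun i : Bool => cond i v' u')
    (by rintro (_ | _) (_ | _) <;> simp [huv, huv.symm])
    (by rintro (_ | _) (_ | _) <;> simp [huv', huv'.symm])
    (by rintro (_ | _) (_ | _) <;> simp [hM.1, h1, h2])
  refine ⟨g, hg, ?_⟩
  have hu : g u ∈ Set.range fun i : Bool => cond i v' u' := h ▸ ⟨u, ⟨false, rfl⟩, rfl⟩
  have hv : g v ∈ Set.range fun i : Bool => cond i v' u' := h ▸ ⟨v, ⟨true, rfl⟩, rfl⟩
  have hne : g u ≠ g v := g.injective.ne huv
  simp only [Set.mem_range, Bool.exists_bool, cond_true, cond_false] at hu hv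
  grind

theorem SetHomogeneous.exists_auto_arc {M : ADigraph V} (hM : M.IsA) (hS : M.SetHomogeneous)
    {u v u' v' : V} (h : M.arc u v) (h' : M.arc u' v') :
    ∃ g : V ≃ V, M.IsAuto g ∧ g u = u' ∧ g v = v' := by
  obtain ⟨g, hg, h1 | h1⟩ := hS.exists_auto_pair hM (hM.ne h) (hM.ne h') (iff_of_true h h')
    (iff_of_false (hM.2 _ _ h) (hM.2 _ _ h'))
  · exact ⟨g, hg, h1⟩
  · rw [hg, h1.1, h1.2] at h
    exact (hM.2 _ _ h h').elim

theorem SetHomogeneous.induce_out {M : ADigraph V} (hM : M.IsA) (hS : M.SetHomogeneous) (a : V) :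
    (M.induce {v | M.arc a v}).SetHomogeneous := by
  rintro U U' hU - ⟨e, he⟩
  have := hU.to_subtype
  have hne : ∀ u : {v | M.arc a v}, (u : V) ≠ a := fun u => (hM.ne u.2).symm
  obtain ⟨g, hg, h⟩ := hS.exists_auto (p := fun o : Option U => o.elim a fun u => u.1.1)
    (q := fun o : Option U => o.elim a fun u => (e u).1.1)
    (by
      rintro (_ | u) (_ | v)
      · simp
      · simpa using (hne _).symm
      · simpa using hne _
      · simp [Subtype.val_inj])
    (by
      rintro (_ | u) (_ | v)
      · simp
      · simpa using (hne _).symm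
      · simpa using hne _
      · simp [Subtype.val_inj])
    (by
      rintro (_ | u) (_ | v)
      · simp
      · exact iff_of_true v.1.2 (e v).1.2
      · exact iff_of_false (hM.2 _ _ u.1.2) (hM.2 _ _ (e u).1.2)
      · exact he u v)
  have hmem : ∀ x : V, x ∈ Set.range (fun o : Option U => o.elim a fun u => (e u).1.1) ↔
      x = a ∨ ∃ y : U', y.1.1 = x := by
    intro x
    constructor
    · rintro ⟨_ | u, rfl⟩
      · exact .inl rfl
      · exact .inr ⟨_, rfl⟩
    · rintro (rfl | ⟨y, rfl⟩)
      · exact ⟨none, rfl⟩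
      · exact ⟨some (e.symm y), by simp⟩
  have hga : g a = a := by
    have h1 := (hmem (g a)).1 (h ▸ ⟨a, ⟨none, rfl⟩, rfl⟩)
    obtain ⟨_, ⟨_ | w, rfl⟩, h2⟩ := h.symm ▸ (hmem a).2 (.inl rfl)
    · exact h2
    · rcases h1 with h1 | ⟨y, hy⟩
      · exact h1
      · have h3 := (hg _ _).1 w.1.2
        simp only [Option.elim_some] at h2
        rw [h2, ← hy] at h3
        exact (hM.2 _ _ h3 y.1.2).elim
  refine ⟨g.subtypeEquiv fun v => ?_, fun u v => hg u v, ?_⟩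
  · simp only [Set.mem_ofPred_eq]
    rw [hg, hga]
  · ext y
    constructor
    · rintro ⟨x, hx, rfl⟩
      rcases (hmem (g x)).1 (h ▸ ⟨x, ⟨some ⟨x, hx⟩, rfl⟩, rfl⟩) with h1 | ⟨y, hy⟩
      · exact (hne x (g.injective (h1.trans hga.symm))).elim
      · rw [show g.subtypeEquiv _ x = y.1 from Subtype.ext hy.symm]
        exact y.2
    · intro hy
      obtain ⟨_, ⟨_ | w, rfl⟩, h2⟩ := h.symm ▸ (hmem y).2 (.inr ⟨⟨y, hy⟩, rfl⟩)
      · exact (hne y (h2.symm.trans hga)).elim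
      · exact ⟨w, w.2, Subtype.ext h2⟩

theorem SetHomogeneous.induce_in {M : ADigraph V} (hM : M.IsA) (hS : M.SetHomogeneous) (a : V) :
    (M.induce {v | M.arc v a}).SetHomogeneous :=
  (hS.rev.induce_out hM.rev a).rev

/-- The out-degree of a vertex. -/
noncomputable def outDeg (M : ADigraph V) (u : V) : ℕ :=
  Nat.card {v // M.arc u v}

theorem outDeg_iso {M : ADigraph V} {N : ADigraph W} (e : V ≃ W)
    (he : ∀ u v, M.arc u v ↔ N.arc (e u) (e v)) (u : V) : N.outDeg (e u) = M.outDeg u :=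
  (Nat.card_congr (e.subtypeEquiv fun v => he u v)).symm

theorem SetHomogeneous.outDeg_eq {M : ADigraph V} (hM : M.IsA) (hS : M.SetHomogeneous) (u v : V) :
    M.outDeg u = M.outDeg v := by
  obtain ⟨g, hg, rfl⟩ := hS.exists_auto_vertex hM u v
  exact (outDeg_iso g hg u).symm

theorem SetHomogeneous.outDeg_rev [Finite V] {M : ADigraph V} (hM : M.IsA)
    (hS : M.SetHomogeneous) (u v : V) : M.rev.outDeg u = M.outDeg v := by
  classical
  have := Fintype.ofFinite V
  have := Finset.card_mul_eq_card_mul (s := Finset.univ) (t := Finset.univ) M.arc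
    (m := M.outDeg v) (n := M.rev.outDeg u)
    (fun a _ => by
      rw [hS.outDeg_eq hM v a, outDeg, Nat.card_eq_fintype_card, Fintype.card_subtype]
      rfl)
    (fun a _ => by
      rw [hS.rev.outDeg_eq hM.rev u a, outDeg, Nat.card_eq_fintype_card, Fintype.card_subtype]
      rfl)
  exact (Nat.eq_of_mul_eq_mul_left (Finset.card_pos.2 ⟨u, Finset.mem_univ u⟩) this).symm

end Basic

section Opposite

variable {V : Type*} {M : ADigraph V}

/-- `v` is opposite to `u` if the in-neighbours of `v` are the out-neighbours of `u`. -/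
def Opposite (M : ADigraph V) (u v : V) : Prop :=
  ∀ w, M.arc u w ↔ M.arc w v

theorem IsAuto.opposite {g : V ≃ V} (hg : M.IsAuto g) {u v : V} (h : M.Opposite u v) :
    M.Opposite (g u) (g v) := fun w => by
  have := h (g.symm w)
  rwa [hg, hg _ v, Equiv.apply_symm_apply] at this

theorem SetHomogeneous.exists_opposite [Finite V] (hS : M.SetHomogeneous) {a c : V}
    (h : (M.induce {v | M.arc a v}).Iso (M.induce {v | M.arc v c})) : ∃ z, M.Opposite a z := by
  obtain ⟨e, he⟩ := h
  obtain ⟨g, hg, hge⟩ := hS.exists_auto (p := fun u : {v | M.arc a v} => (e u : V))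
    (q := fun u : {v | M.arc a v} => (u : V))
    (Subtype.val_injective.comp e.injective) Subtype.val_injective (fun i j => (he i j).symm)
  refine ⟨g c, fun w => ?_⟩
  have h1 : M.arc a w ↔ w ∈ Set.range fun u : {v | M.arc a v} => (u : V) := by simp
  rw [h1, ← hge]
  constructor
  · rintro ⟨_, ⟨u, rfl⟩, rfl⟩
    exact (hg _ _).1 (e u).2
  · intro hw
    have h2 : M.arc (g.symm w) c := by rwa [hg, Equiv.apply_symm_apply]
    exact ⟨g.symm w, ⟨e.symm ⟨_, h2⟩, by simp⟩, by simp⟩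

/-- If some opposite pair is an arc, then every arc is an opposite pair; otherwise opposite pairs
are exactly the pairs of non-adjacent vertices, up to order. -/
theorem SetHomogeneous.opposite_cases (hM : M.IsA) (hS : M.SetHomogeneous) {a b z : V}
    (hab : M.arc a b) (hz : M.Opposite a z) :
    (∀ u v, M.arc u v → M.Opposite v u) ∨
    (¬ M.arc z a ∧ ∀ u v, u ≠ v → ¬ M.arc u v → ¬ M.arc v u → M.Opposite u v ∨ M.Opposite v u) := by
  have hne : a ≠ z := by
    rintro rfl
    exact hM.2 _ _ hab ((hz b).1 hab)
  have haz : ¬ M.arc a z := fun h => hM.1 _ ((hz z).1 h)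
  by_cases hza : M.arc z a
  · left
    intro u v huv
    obtain ⟨g, hg, rfl, rfl⟩ := hS.exists_auto_arc hM hza huv
    exact hg.opposite hz
  · right
    refine ⟨hza, fun u v huv h1 h2 => ?_⟩
    obtain ⟨g, hg, ⟨rfl, rfl⟩ | ⟨rfl, rfl⟩⟩ := hS.exists_auto_pair hM hne huv
      (iff_of_false haz h1) (iff_of_false hza h2)
    · exact .inl (hg.opposite hz)
    · exact .inr (hg.opposite hz)

theorem not_opposite_of_common_in (hM : M.IsA) {a b b' : V} (hb : M.arc a b) (hb' : M.arc a b') :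
    ¬ M.Opposite b b' := fun h => hM.2 _ _ hb ((h a).2 hb')

end Opposite

/-- The determinant form on `GF(3)²` that defines the arcs of `H0`. -/
def detForm (x y : Fin 2 → ZMod 3) : ZMod 3 := x 0 * y 1 - x 1 * y 0

theorem detForm_expand {u v : Fin 2 → ZMod 3} (h : detForm u v = 1) (w : Fin 2 → ZMod 3) :
    detForm u w • v + detForm w v • u = w := by
  unfold detForm at *
  ext i
  fin_cases i
  · simp
    linear_combination w 0 * h
  · simp
    linear_combination w 1 * h

theorem detForm_comb_right {u v : Fin 2 → ZMod 3} (h : detForm u v = 1) (a b : ZMod 3) :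
    detForm u (a • v + b • u) = a := by
  unfold detForm at *
  simp
  linear_combination a * h

theorem detForm_comb_left {u v : Fin 2 → ZMod 3} (h : detForm u v = 1) (a b : ZMod 3) :
    detForm (a • v + b • u) v = b := by
  unfold detForm at *
  simp
  linear_combination b * h

theorem detForm_comb_comb {u v : Fin 2 → ZMod 3} (h : detForm u v = 1) (a b c d : ZMod 3) :
    detForm (a • v + b • u) (c • v + d • u) = b * c - a * d := by
  unfold detForm at *
  simp
  linear_combination (b * c - a * d) * h

theorem detForm_comb_ne_zero {u v u' v' : Fin 2 → ZMod 3} (h : detForm u v = 1)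
    (h' : detForm u' v' = 1) {w : Fin 2 → ZMod 3} (hw : w ≠ 0) :
    detForm u w • v' + detForm w v • u' ≠ 0 := by
  intro h0
  have h1 := detForm_comb_right h' (detForm u w) (detForm w v)
  have h2 := detForm_comb_left h' (detForm u w) (detForm w v)
  rw [h0] at h1 h2
  apply hw
  rw [← detForm_expand h w, ← h1, ← h2]
  simp [detForm]

/-- The automorphism of `H0` given by the linear map taking the basis `u, v` to `u', v'`. -/
theorem exists_isAuto_H0 {u v u' v' : Fin 2 → ZMod 3} (h : detForm u v = 1)
    (h' : detForm u' v' = 1) :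
    ∃ g : {v : Fin 2 → ZMod 3 // v ≠ 0} ≃ {v : Fin 2 → ZMod 3 // v ≠ 0}, H0.IsAuto g ∧
      ∀ w w' : {v : Fin 2 → ZMod 3 // v ≠ 0}, detForm u w = detForm u' w' →
        detForm w v = detForm w' v' → g w = w' := by
  refine ⟨⟨fun w => ⟨detForm u w • v' + detForm w v • u', detForm_comb_ne_zero h h' w.2⟩,
    fun w => ⟨detForm u' w • v + detForm w v' • u, detForm_comb_ne_zero h' h w.2⟩, ?_, ?_⟩, ?_, ?_⟩
  · intro w
    ext1
    simp only [detForm_comb_right h', detForm_comb_left h', detForm_expand h]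
  · intro w
    ext1
    simp only [detForm_comb_right h, detForm_comb_left h, detForm_expand h']
  · intro w w'
    change detForm w w' = 1 ↔ detForm _ _ = 1
    simp only [Equiv.coe_fn_mk, detForm_comb_comb h']
    rw [← detForm_comb_comb h, detForm_expand h, detForm_expand h]
  · intro w w' h1 h2
    ext1
    simp only [Equiv.coe_fn_mk, h1, h2, detForm_expand h']

theorem homogeneous_H0 : H0.Homogeneous := by
  intro U U' _ _ e he
  change ∀ u v : U, detForm u v = 1 ↔ detForm (e u) (e v) = 1 at he
  have key : ∀ u v : U, detForm u v = detForm (e u) (e v) := fun u v => by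
    have h1 := he u v
    have h2 := he v u
    rw [show detForm (v : {v : Fin 2 → ZMod 3 // v ≠ 0}) u = -detForm u v by
      unfold detForm; ring, show detForm (e v : {v : Fin 2 → ZMod 3 // v ≠ 0}) (e u) =
        -detForm (e u) (e v) by unfold detForm; ring] at h2
    generalize detForm (u : {v : Fin 2 → ZMod 3 // v ≠ 0}) v = x at *
    generalize detForm (e u : {v : Fin 2 → ZMod 3 // v ≠ 0}) (e v) = y at *
    revert x y
    decide
  rcases isEmpty_or_nonempty U with hU | ⟨⟨u⟩⟩
  · exact ⟨Equiv.refl _, fun _ _ => Iff.rfl, fun u => hU.elim u⟩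
  by_cases hUarc : ∃ u v : U, detForm u v = 1
  · obtain ⟨u, v, huv⟩ := hUarc
    obtain ⟨g, hg, hge⟩ := exists_isAuto_H0 huv ((he u v).1 huv)
    exact ⟨g, hg, fun w => hge _ _ (key u w) (key w v)⟩
  · push Not at hUarc
    have hex : ∀ x : {v : Fin 2 → ZMod 3 // v ≠ 0}, ∃ y : Fin 2 → ZMod 3, detForm x y = 1 := by
      decide +kernel
    have hneg : ∀ x w y : Fin 2 → ZMod 3, detForm x y = 1 → detForm x w = 0 → w ≠ 0 →
        w ≠ x → detForm w y = -1 := by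
      unfold detForm
      decide +kernel
    have hzero : ∀ w : U, detForm u w = 0 := fun w => by
      have h1 := hUarc u w
      have h2 := hUarc w u
      rw [show detForm (w : {v : Fin 2 → ZMod 3 // v ≠ 0}) u = -detForm u w by
        unfold detForm; ring] at h2
      generalize detForm (u : {v : Fin 2 → ZMod 3 // v ≠ 0}) w = x at *
      revert x
      decide
    obtain ⟨v, hv⟩ := hex u
    obtain ⟨v', hv'⟩ := hex (e u)
    obtain ⟨g, hg, hge⟩ := exists_isAuto_H0 hv hv'
    refine ⟨g, hg, fun w => hge _ _ (key u w) ?_⟩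
    by_cases hw : w = u
    · rw [hw, hv, hv']
    · rw [hneg _ _ _ hv (hzero w) w.1.2 (by simpa [Subtype.val_inj] using hw),
        hneg _ _ _ hv' (key u w ▸ hzero w) (e w).1.2 (by simpa [Subtype.val_inj] using hw)]

theorem homogeneous_kbar_comp (n : ℕ) : ((kbar n).comp (dirCycle 3)).Homogeneous := by
  classical
  intro U U' _ _ e he
  change ∀ u v : U, (False ∨ (u : Fin n × ZMod 3).1 = (v : Fin n × ZMod 3).1 ∧
    ((v : Fin n × ZMod 3).2 = (u : Fin n × ZMod 3).2 + 1 ∧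
      (u : Fin n × ZMod 3).2 ≠ (v : Fin n × ZMod 3).2)) ↔
    (False ∨ (e u : Fin n × ZMod 3).1 = (e v : Fin n × ZMod 3).1 ∧
    ((e v : Fin n × ZMod 3).2 = (e u : Fin n × ZMod 3).2 + 1 ∧
      (e u : Fin n × ZMod 3).2 ≠ (e v : Fin n × ZMod 3).2)) at he
  have hcyc : ∀ x y : ZMod 3, x = y ∨ y = x + 1 ∧ x ≠ y ∨ x = y + 1 ∧ y ≠ x := by decide
  have key : ∀ u v : U, (u : Fin n × ZMod 3).1 = (v : Fin n × ZMod 3).1 →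
      (e u : Fin n × ZMod 3).1 = (e v : Fin n × ZMod 3).1 ∧
      (e u : Fin n × ZMod 3).2 - (u : Fin n × ZMod 3).2 =
        (e v : Fin n × ZMod 3).2 - (v : Fin n × ZMod 3).2 := by
    intro u v huv
    rcases hcyc (u : Fin n × ZMod 3).2 (v : Fin n × ZMod 3).2 with h | h | h
    · rw [Subtype.ext (Prod.ext huv h)]
      simp
    · have := ((he u v).1 (.inr ⟨huv, h⟩)).resolve_left id
      refine ⟨this.1, ?_⟩
      rw [this.2.1, h.1]
      ring
    · have := ((he v u).1 (.inr ⟨huv.symm, h⟩)).resolve_left id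
      refine ⟨this.1.symm, ?_⟩
      rw [this.2.1, h.1]
      ring
  have key' : ∀ u v : U, (e u : Fin n × ZMod 3).1 = (e v : Fin n × ZMod 3).1 →
      (u : Fin n × ZMod 3).1 = (v : Fin n × ZMod 3).1 := by
    intro u v huv
    rcases hcyc (e u : Fin n × ZMod 3).2 (e v : Fin n × ZMod 3).2 with h | h | h
    · rw [e.injective (Subtype.ext (Prod.ext huv h))]
    · exact (((he u v).2 (.inr ⟨huv, h⟩)).resolve_left id).1
    · exact (((he v u).2 (.inr ⟨huv.symm, h⟩)).resolve_left id).1.symm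
  have hP : ∀ i, ∃ u : Fin n × ZMod 3, ∀ w : U, (w : Fin n × ZMod 3).1 = i →
      (e w : Fin n × ZMod 3) = (u.1, (w : Fin n × ZMod 3).2 + u.2) := by
    intro i
    by_cases hi : ∃ u : U, (u : Fin n × ZMod 3).1 = i
    · obtain ⟨u, rfl⟩ := hi
      refine ⟨((e u : Fin n × ZMod 3).1, (e u : Fin n × ZMod 3).2 - (u : Fin n × ZMod 3).2),
        fun w hw => ?_⟩
      obtain ⟨h1, h2⟩ := key _ _ hw
      rw [← h1, ← h2]
      simp
    · exact ⟨(i, 0), fun w hw => (hi ⟨w, hw⟩).elim⟩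
  choose F hF using hP
  obtain ⟨σ, hσ⟩ := exists_perm_extending {i | ∃ u : U, (u : Fin n × ZMod 3).1 = i}
    (fun i => (F i).1) (by
      rintro _ ⟨u, rfl⟩ _ ⟨v, rfl⟩ h
      apply key'
      rw [hF _ u rfl, hF _ v rfl]
      exact h)
  refine ⟨(Equiv.prodShear σ fun i => Equiv.addRight (F i).2), ?_, ?_⟩
  · rintro ⟨i, x⟩ ⟨j, y⟩
    simp only [comp, kbar, dirCycle, Equiv.prodShear_apply, EmbeddingLike.apply_eq_iff_eq, false_or]
    refine and_congr_right fun h => ?_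
    subst h
    simp [add_right_comm x _ 1]
  · intro u
    have := hσ _ ⟨u, rfl⟩
    rw [hF _ u rfl]
    simp [this]

theorem homogeneous_comp_kbar (n : ℕ) : ((dirCycle 3).comp (kbar n)).Homogeneous := by
  classical
  intro U U' _ _ e he
  change ∀ u v : U, (((v : ZMod 3 × Fin n).1 = (u : ZMod 3 × Fin n).1 + 1 ∧
      (u : ZMod 3 × Fin n).1 ≠ (v : ZMod 3 × Fin n).1) ∨ _ ∧ False) ↔
    (((e v : ZMod 3 × Fin n).1 = (e u : ZMod 3 × Fin n).1 + 1 ∧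
      (e u : ZMod 3 × Fin n).1 ≠ (e v : ZMod 3 × Fin n).1) ∨ _ ∧ False) at he
  simp only [and_false, or_false] at he
  obtain ⟨r, hr⟩ : ∃ r, ∀ u : U, (e u : ZMod 3 × Fin n).1 = (u : ZMod 3 × Fin n).1 + r := by
    rcases isEmpty_or_nonempty U with hU | ⟨⟨u⟩⟩
    · exact ⟨0, fun u => hU.elim u⟩
    · refine ⟨(e u : ZMod 3 × Fin n).1 - (u : ZMod 3 × Fin n).1, fun v => ?_⟩
      have h1 := he u v
      have h2 := he v u
      generalize (u : ZMod 3 × Fin n).1 = a at *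
      generalize (v : ZMod 3 × Fin n).1 = b at *
      generalize (e u : ZMod 3 × Fin n).1 = c at *
      generalize (e v : ZMod 3 × Fin n).1 = d at *
      clear he
      revert a b c d
      decide +kernel
  have hσ : ∀ i : ZMod 3, ∃ σ : Fin n ≃ Fin n, ∀ j ∈ {j | (i, j) ∈ U}, σ j =
      if h : (i, j) ∈ U then (e ⟨(i, j), h⟩ : ZMod 3 × Fin n).2 else j := fun i =>
    exists_perm_extending _ _ (by
      intro j hj k hk h
      simp only [Set.mem_ofPred_eq] at hj hk
      simp only [hj, hk, dif_pos] at h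
      have h' : e ⟨(i, j), hj⟩ = e ⟨(i, k), hk⟩ :=
        Subtype.ext (Prod.ext (by rw [hr, hr]) h)
      simpa using h')
  choose σ hσ using hσ
  refine ⟨(Equiv.prodShear (Equiv.addRight r) σ), ?_, ?_⟩
  · rintro ⟨i, x⟩ ⟨j, y⟩
    simp [comp, kbar, dirCycle, add_right_comm i r 1]
  · intro u
    have := hσ (u : ZMod 3 × Fin n).1 (u : ZMod 3 × Fin n).2 u.2
    refine Prod.ext (hr u).symm ?_
    simp only [Equiv.prodShear_apply]
    rw [this, dif_pos (by simp)]

section Recognition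

variable {V : Type*} {M : ADigraph V}

theorem iso_kbar [Finite V] (h : ∀ u v, ¬ M.arc u v) : M.Iso (kbar (Nat.card V)) :=
  ⟨Finite.equivFin V, fun u v => by simp [h, kbar]⟩

theorem iso_dirCycle {m : ℕ} [NeZero m] (hM : M.IsA) {f : V → V}
    (hf : ∀ u v, M.arc u v ↔ v = f u) {u : V} (hu : ∀ v, ∃ k : ℕ, v = f^[k] u)
    (hm : Function.minimalPeriod f u = m) : M.Iso (dirCycle m) := by
  let G : ZMod m → V := fun i => f^[i.val] u
  have hG : ∀ k : ℕ, G k = f^[k] u := fun k => by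
    simp only [G, ZMod.val_natCast]
    rw [← hm, Function.iterate_mod_minimalPeriod_eq]
  have hinj : G.Injective := by
    intro i j hij
    have h1 : i.val < Function.minimalPeriod f u := hm ▸ i.val_lt
    have h2 : j.val < Function.minimalPeriod f u := hm ▸ j.val_lt
    exact ZMod.val_injective m ((Function.iterate_eq_iterate_iff_of_lt_minimalPeriod h1 h2).1 hij)
  have hsurj : G.Surjective := fun v => by
    obtain ⟨k, rfl⟩ := hu v
    exact ⟨k, hG k⟩
  have hsucc : ∀ i, f (G i) = G (i + 1) := fun i => by
    have := hG (i.val + 1)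
    rw [Function.iterate_succ_apply'] at this
    simpa [G] using this.symm
  refine Iso.symm ⟨Equiv.ofBijective G ⟨hinj, hsurj⟩, fun i j => ?_⟩
  change (j = i + 1 ∧ i ≠ j) ↔ M.arc (G i) (G j)
  rw [hf, hsucc, hinj.eq_iff]
  refine and_iff_left_of_imp fun h h' => hM.1 (G i) ((hf _ _).2 ?_)
  rw [hsucc, ← h, ← h']

theorem iso_kbar_comp [Finite V] (hM : M.IsA) {f : V ≃ V}
    (hf : ∀ u v, M.arc u v ↔ v = f u) (h3 : ∀ v, f (f (f v)) = v) :
    ∃ n, M.Iso ((kbar n).comp (dirCycle 3)) := by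
  let s := Equiv.Perm.SameCycle.setoid f
  have h1 : ∀ v, f v ≠ v := fun v h => hM.1 v ((hf _ _).2 h.symm)
  let G : Quotient s × ZMod 3 → V := fun p => (f : V → V)^[p.2.val] p.1.out
  have hG : ∀ p, Equiv.Perm.SameCycle f p.1.out (G p) := fun p =>
    ⟨p.2.val, by rw [zpow_natCast, Equiv.Perm.coe_pow]⟩
  have hmk : ∀ p, (Quotient.mk s (G p)) = p.1 := fun p => by
    conv_rhs => rw [← p.1.out_eq]
    exact Quotient.sound (hG p).symm
  have hsucc : ∀ q i, f (G (q, i)) = G (q, i + 1) := by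
    intro q i
    fin_cases i
    · rfl
    · rfl
    · exact h3 _
  have hinj : G.Injective := by
    rintro ⟨q, i⟩ ⟨q', j⟩ h
    obtain rfl : q = q' := (hmk (q, i)).symm.trans ((congrArg _ h).trans (hmk (q', j)))
    have h2 : ∀ k, G (q, k) ≠ G (q, k + 1) := fun k h => h1 _ ((hsucc q k).trans h.symm)
    have h4 : ∀ i j : ZMod 3, i = j ∨ j = i + 1 ∨ i = j + 1 := by decide
    rcases h4 i j with rfl | rfl | rfl
    · rfl
    · exact (h2 _ h).elim
    · exact (h2 _ h.symm).elim
  have hsurj : G.Surjective := by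
    intro v
    have hv : Equiv.Perm.SameCycle f (Quotient.mk s v).out v := Quotient.mk_out (s := s) v
    obtain ⟨k, -, hk⟩ := hv.exists_pow_eq'
    refine ⟨(Quotient.mk s v, k), ?_⟩
    have h5 : ∀ x, Function.IsPeriodicPt f 3 x := h3
    simp only [G, ZMod.val_natCast]
    rw [(h5 _).iterate_mod_apply, ← Equiv.Perm.coe_pow, hk]
  refine ⟨Nat.card (Quotient s), Iso.symm
    ⟨((Finite.equivFin _).symm.prodCongr (Equiv.refl _)).trans (Equiv.ofBijective G ⟨hinj, hsurj⟩),
      ?_⟩⟩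
  rintro ⟨q, i⟩ ⟨q', j⟩
  have hij : ∀ i j : ZMod 3, j = i + 1 → i ≠ j := by decide
  have h6 : ((kbar (Nat.card (Quotient s))).comp (dirCycle 3)).arc (q, i) (q', j) ↔
      q = q' ∧ j = i + 1 ∧ i ≠ j := iff_of_eq (false_or _)
  rw [h6, hf]
  change _ ↔ G ((Finite.equivFin _).symm q', j) = f (G ((Finite.equivFin _).symm q, i))
  rw [hsucc, hinj.eq_iff, Prod.mk.injEq, EmbeddingLike.apply_eq_iff_eq, eq_comm,
    and_iff_left_of_imp (hij i j)]

theorem iso_comp_kbar {d : ℕ} {φ : V → ZMod 3} (h : ∀ u v, M.arc u v ↔ φ v = φ u + 1)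
    (hφ : ∀ i, Nonempty ({v // φ v = i} ≃ Fin d)) : M.Iso ((dirCycle 3).comp (kbar d)) := by
  refine ⟨(Equiv.sigmaFiberEquiv φ).symm.trans
    ((Equiv.sigmaCongrRight fun i => (hφ i).some).trans (Equiv.sigmaEquivProd _ _)), fun u v => ?_⟩
  have hij : ∀ i j : ZMod 3, j = i + 1 → i ≠ j := by decide
  simp only [h, comp, dirCycle, kbar, and_false, or_false]
  exact ⟨fun h => ⟨h, hij _ _ h⟩, fun h => h.1⟩

end Recognition

section TransitiveFree

variable {V : Type*} {M : ADigraph V}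

theorem exists_perm_of_outDeg_eq_one [Finite V] (h : ∀ u, M.outDeg u = 1)
    (h' : ∀ u, M.rev.outDeg u = 1) : ∃ f : V ≃ V, ∀ u v, M.arc u v ↔ v = f u := by
  have h1 : ∀ u, ∃ v, ∀ w, M.arc u w ↔ w = v := fun u => by
    obtain ⟨_, ⟨v, hv⟩⟩ := Nat.card_eq_one_iff_unique.1 (h u)
    exact ⟨v, fun w => ⟨fun hw => congrArg Subtype.val (Subsingleton.elim
      (α := {v // M.arc u v}) ⟨w, hw⟩ ⟨v, hv⟩), fun hw => hw ▸ hv⟩⟩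
  choose f hf using h1
  have hinj : f.Injective := fun u u' huu => by
    have := (Nat.card_eq_one_iff_unique.1 (h' (f u))).1
    exact congrArg Subtype.val (Subsingleton.elim (α := {v // M.rev.arc (f u) v})
      ⟨u, (hf _ _).2 rfl⟩ ⟨u', (hf _ _).2 huu⟩)
  exact ⟨Equiv.ofBijective f (Finite.injective_iff_bijective.1 hinj), hf⟩

theorem SetHomogeneous.iso_of_outDeg_eq_one [Finite V] (hM : M.IsA) (hS : M.SetHomogeneous)
    (h : ∀ u, M.outDeg u = 1) :
    M.Iso (dirCycle 4) ∨ M.Iso (dirCycle 5) ∨ ∃ n, M.Iso ((kbar n).comp (dirCycle 3)) := by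
  obtain ⟨f, hf⟩ := exists_perm_of_outDeg_eq_one h fun u => (hS.outDeg_rev hM u u).trans (h u)
  by_cases h3 : ∀ v, f (f (f v)) = v
  · exact .inr (.inr (iso_kbar_comp hM hf h3))
  push Not at h3
  obtain ⟨u, h3⟩ := h3
  have h1 : ∀ v, f v ≠ v := fun v h => hM.1 v ((hf _ _).2 h.symm)
  have h2 : ∀ v, f (f v) ≠ v := fun v h => hM.2 v (f v) ((hf _ _).2 rfl) ((hf _ _).2 h.symm)
  have hcomm : ∀ {g : V ≃ V}, M.IsAuto g → ∀ v, g (f v) = f (g v) := fun hg v =>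
    (hf _ _).1 ((hg _ _).1 ((hf _ _).2 rfl))
  have key : ∀ v, v ≠ u → v ≠ f u → f v ≠ u → v = f (f u) ∨ f (f v) = u := by
    intro v hv1 hv2 hv3
    obtain ⟨g, hg, ⟨hu, hv⟩ | ⟨hu, hv⟩⟩ := hS.exists_auto_pair hM (h2 u).symm hv1.symm
      (by simp [hf, hv2, h1]) (by simp [hf, hv3.symm, h3.symm])
    · rw [hcomm hg, hcomm hg, hu] at hv
      exact .inl hv.symm
    · rw [hcomm hg, hcomm hg, hu] at hv
      exact .inr hv
  have hinj := f.injective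
  have h45 : f (f (f (f u))) = u ∨ f (f (f (f (f u)))) = u := by
    by_cases h4 : f (f (f (f u))) = u
    · exact .inl h4
    · rcases key _ h3 (fun h => h2 u (hinj h)) h4 with h5 | h5
      · exact (h1 _ (hinj h5)).elim
      · exact .inr h5
  have hper : ∀ m, 0 < m → (f : V → V)^[m] u = u → ∀ v, ∃ k : ℕ, v = (f : V → V)^[k] u := by
    intro m hm hmu v
    have hback : ∀ w, (∃ k : ℕ, f w = (f : V → V)^[k] u) → ∃ k : ℕ, w = (f : V → V)^[k] u := by
      rintro w ⟨_ | k, hk⟩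
      · refine ⟨m - 1, hinj ?_⟩
        rw [hk, ← Function.iterate_succ_apply' f, Nat.succ_eq_add_one, Nat.sub_add_cancel hm, hmu]
        rfl
      · rw [Function.iterate_succ_apply'] at hk
        exact ⟨k, hinj hk⟩
    by_cases hv1 : v = u
    · exact ⟨0, hv1⟩
    by_cases hv2 : v = f u
    · exact ⟨1, hv2⟩
    by_cases hv3 : f v = u
    · exact hback _ ⟨0, hv3⟩
    rcases key v hv1 hv2 hv3 with h | h
    · exact ⟨2, h⟩
    · exact hback _ (hback _ ⟨0, h⟩)
  rcases h45 with h4 | h5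
  · refine .inl (iso_dirCycle hM hf (hper 4 (by norm_num) h4) ?_)
    exact Function.minimalPeriod_eq_prime_pow (p := 2) (k := 1) (h2 u) h4
  · refine .inr (.inl (iso_dirCycle hM hf (hper 5 (by norm_num) h5) ?_))
    have : Fact (Nat.Prime 5) := ⟨by norm_num⟩
    exact Function.minimalPeriod_eq_prime h5 (h1 u)

theorem SetHomogeneous.iso_of_transitive_free [Finite V] [Nonempty V] (hM : M.IsA)
    (hS : M.SetHomogeneous)
    (hT : ∀ a b c, M.arc a b → M.arc a c → ¬ M.arc b c) {d : ℕ} (hd : 2 ≤ d)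
    (h : ∀ u, M.outDeg u = d) : M.Iso ((dirCycle 3).comp (kbar d)) := by
  have hin : ∀ u, M.rev.outDeg u = d := fun u => (hS.outDeg_rev hM u u).trans (h u)
  obtain ⟨a⟩ := ‹Nonempty V›
  obtain ⟨z, hz⟩ : ∃ z, M.Opposite a z := by
    obtain ⟨e⟩ := Finite.card_eq.1 ((h a).trans (hin a).symm)
    refine hS.exists_opposite (c := a) ⟨e, fun u v => iff_of_false ?_ ?_⟩
    · exact hT a u v u.2 v.2
    · exact fun huv => hT _ _ _ huv (e u).2 (e v).2
  have : Nontrivial {v // M.arc a v} := Finite.one_lt_card_iff_nontrivial.1 (by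
    have := h a
    rw [outDeg] at this
    omega)
  obtain ⟨⟨b, hb⟩, ⟨b', hb'⟩, hbb⟩ := exists_pair_ne {v // M.arc a v}
  have hbb : b ≠ b' := fun h => hbb (Subtype.ext h)
  have hopp : ∀ u v, M.arc u v → M.Opposite v u := by
    refine (hS.opposite_cases hM hb hz).resolve_right fun ⟨_, H⟩ => ?_
    rcases H b b' hbb (hT _ _ _ hb hb') (hT _ _ _ hb' hb) with h | h
    · exact not_opposite_of_common_in hM hb hb' h
    · exact not_opposite_of_common_in hM hb' hb h
  have hcommon : ∀ u v, u ≠ v → ¬ M.arc u v → ¬ M.arc v u → ∃ y, M.arc y u ∧ M.arc y v := by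
    intro u v huv h1 h2
    obtain ⟨g, hg, ⟨rfl, rfl⟩ | ⟨rfl, rfl⟩⟩ := hS.exists_auto_pair hM hbb huv
      (iff_of_false (hT _ _ _ hb hb') h1) (iff_of_false (hT _ _ _ hb' hb) h2)
    · exact ⟨g a, (hg _ _).1 hb, (hg _ _).1 hb'⟩
    · exact ⟨g a, (hg _ _).1 hb', (hg _ _).1 hb⟩
  have hA : ∀ x, ¬ M.arc a x → ¬ M.arc x a →
      ∀ w, (M.arc x w ↔ M.arc a w) ∧ (M.arc w x ↔ M.arc w a) := by
    intro x h1 h2 w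
    rcases eq_or_ne a x with rfl | hax
    · simp
    obtain ⟨y, hya, hyx⟩ := hcommon a x hax h1 h2
    obtain ⟨c, hc⟩ : ∃ c, M.arc a c := ⟨b, hb⟩
    have h3 : ∀ w, M.arc x w ↔ M.arc a w := fun w => (hopp _ _ hyx w).trans (hopp _ _ hya w).symm
    exact ⟨h3 w, (hopp _ _ ((h3 c).2 hc) w).symm.trans (hopp _ _ hc w)⟩
  classical
  let φ : V → ZMod 3 := fun v => if M.arc a v then 1 else if M.arc v a then 2 else 0
  have h012 : (0 : ZMod 3) ≠ 1 ∧ (1 : ZMod 3) ≠ 2 ∧ (2 : ZMod 3) ≠ 0 := by decide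
  obtain ⟨h01, h12, h20⟩ := h012
  have hφ1 : ∀ v, φ v = 1 ↔ M.arc a v := fun v => by
    simp only [φ]; split_ifs <;> simp_all [h12.symm]
  have hφ2 : ∀ v, φ v = 2 ↔ M.arc v a := fun v => by
    have := hM.2 a v
    simp only [φ]; split_ifs <;> simp_all [h20.symm]
  have hφ0 : ∀ v, φ v = 0 ↔ ¬ M.arc a v ∧ ¬ M.arc v a := fun v => by
    simp only [φ]; split_ifs <;> simp_all [h01.symm]
  have hφ : ∀ u v, M.arc u v ↔ φ v = φ u + 1 := by
    intro u v
    by_cases h1 : M.arc a u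
    · rw [(hφ1 u).2 h1, show (1 + 1 : ZMod 3) = 2 from rfl, hφ2, hopp _ _ h1 v]
    by_cases h2 : M.arc u a
    · rw [(hφ2 u).2 h2, show (2 + 1 : ZMod 3) = 0 from rfl, hφ0]
      refine ⟨fun h3 => ⟨fun h4 => ?_, fun h4 => hT _ _ _ h3 h2 h4⟩, fun h3 => ?_⟩
      · exact hM.2 _ _ h3 ((hopp _ _ h2 v).1 h4)
      · exact ((hA v h3.1 h3.2 u).2).2 h2
    · rw [(hφ0 u).2 ⟨h1, h2⟩, zero_add, hφ1, (hA u h1 h2 v).1]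
  refine iso_comp_kbar hφ fun i => ?_
  obtain ⟨u, hu⟩ : ∃ u, φ u + 1 = i := by
    obtain ⟨c, hc⟩ : ∃ c, M.arc b c := by
      have : Nonempty {v // M.arc b v} := (Nat.card_pos_iff.1 (by
        have := h b
        rw [outDeg] at this
        omega)).1
      exact nonempty_subtype.1 this
    have h0 := (hφ0 a).2 ⟨hM.1 a, hM.1 a⟩
    have h1 := (hφ1 b).2 hb
    have h2 : φ c = 2 := by rw [(hφ b c).1 hc, h1]; rfl
    fin_cases i
    · exact ⟨c, by rw [h2]; rfl⟩
    · exact ⟨a, by rw [h0]; rfl⟩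
    · exact ⟨b, by rw [h1]; rfl⟩
  refine ⟨Finite.equivFinOfCardEq ?_⟩
  rw [← h u, outDeg]
  exact Nat.card_congr (Equiv.subtypeEquivRight fun v => by rw [hφ, hu])

end TransitiveFree

section Octahedral

variable {V : Type*} {M : ADigraph V}

/-- The nonzero vectors of `GF(3)²` as signed multiples of four representatives: a vector and its
three out-neighbours in `H0`. -/
def signedVec (x : Fin 4 × Bool) : {v : Fin 2 → ZMod 3 // v ≠ 0} :=
  ⟨(if x.2 then -1 else 1 : ZMod 3) • (![![1, 0], ![0, 1], ![2, 1], ![1, 1]] x.1), by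
    revert x; decide⟩

instance : DecidableRel H0.arc := fun _ _ => inferInstanceAs (Decidable (_ = _))

theorem signedVec_bijective : signedVec.Bijective := by decide +kernel

theorem signedVec_ext : ∀ x y, (∀ w, H0.arc (signedVec x) (signedVec w) ↔
    H0.arc (signedVec y) (signedVec w)) → x = y := by
  decide +kernel

theorem arc_signedVec_not_left : ∀ i s y, H0.arc (signedVec (i, !s)) (signedVec y) ↔
    H0.arc (signedVec y) (signedVec (i, s)) := by
  decide +kernel

theorem arc_signedVec_not_right : ∀ x i s, H0.arc (signedVec x) (signedVec (i, !s)) ↔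
    H0.arc (signedVec (i, s)) (signedVec x) := by
  decide +kernel

theorem Opposite.right_unique (hM : M.IsA) (hout : ∀ a, ∃ b, M.arc a b)
    (hind : ∀ u v, u ≠ v → ¬ M.arc u v → ¬ M.arc v u → M.Opposite u v ∨ M.Opposite v u)
    {u z z' : V} (h : M.Opposite u z) (h' : M.Opposite u z') : z = z' := by
  have hzz : ∀ w, M.arc w z ↔ M.arc w z' := fun w => (h w).symm.trans (h' w)
  by_contra hne
  rcases hind z z' hne (fun h => hM.1 z ((hzz z).2 h)) (fun h => hM.1 z' ((hzz z').1 h)) with h1 | h1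
  · obtain ⟨w, hw⟩ := hout z
    exact hM.2 _ _ hw ((hzz w).2 ((h1 w).1 hw))
  · obtain ⟨w, hw⟩ := hout z'
    exact hM.2 _ _ hw ((hzz w).1 ((h1 w).1 hw))

theorem Opposite.left_unique (hM : M.IsA) (hout : ∀ a, ∃ b, M.arc a b)
    (hind : ∀ u v, u ≠ v → ¬ M.arc u v → ¬ M.arc v u → M.Opposite u v ∨ M.Opposite v u)
    {u u' z : V} (h : M.Opposite u z) (h' : M.Opposite u' z) : u = u' := by
  have huu : ∀ w, M.arc u w ↔ M.arc u' w := fun w => (h w).trans (h' w).symm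
  by_contra hne
  rcases hind u u' hne (fun h => hM.1 u' ((huu u').1 h)) (fun h => hM.1 u ((huu u).2 h)) with h1 | h1
  · obtain ⟨w, hw⟩ := hout u
    exact hM.2 _ _ ((huu w).1 hw) ((h1 w).1 hw)
  · obtain ⟨w, hw⟩ := hout u
    exact hM.2 _ _ hw ((h1 w).1 ((huu w).1 hw))

/-- If all out-neighbourhoods are directed triangles and non-adjacent vertices are opposite,
then being opposite is a symmetric relation. -/
theorem Opposite.symm_of_triangles (hM : M.IsA)
    (htri : ∀ a, ∃ b₀ b₁ b₂, (∀ w, M.arc a w ↔ w = b₀ ∨ w = b₁ ∨ w = b₂) ∧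
      M.arc b₀ b₁ ∧ M.arc b₁ b₂ ∧ M.arc b₂ b₀)
    (hopp : ∀ a, ∃ z, M.Opposite a z)
    (hind : ∀ u v, u ≠ v → ¬ M.arc u v → ¬ M.arc v u → M.Opposite u v ∨ M.Opposite v u)
    (hadj : ∀ u v, M.Opposite u v → ¬ M.arc v u) {a z : V} (h : M.Opposite a z) :
    M.Opposite z a := by
  have hout : ∀ a, ∃ b, M.arc a b := fun a => by
    obtain ⟨b, _, _, hb, -⟩ := htri a
    exact ⟨b, (hb b).2 (.inl rfl)⟩
  obtain ⟨Z, hZ⟩ := hopp z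
  by_cases hne : a = Z
  · exact hne ▸ hZ
  exfalso
  have htri' : ∀ {x y y₁ y₂}, M.arc x y → M.arc x y₁ → M.arc x y₂ → M.arc y y₁ → M.arc y y₂ →
      y₁ = y₂ := by
    intro x y y₁ y₂ hy hy₁ hy₂ h1 h2
    obtain ⟨b₀, b₁, b₂, hb, h01, h12, h20⟩ := htri x
    rw [hb] at hy hy₁ hy₂
    have h3 := hM.1
    have h4 := hM.2
    grind
  have htour : ∀ {x y y'}, M.arc x y → M.arc x y' → y ≠ y' → M.arc y y' ∨ M.arc y' y := by
    intro x y y' hy hy' hne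
    obtain ⟨b₀, b₁, b₂, hb, h01, h12, h20⟩ := htri x
    rw [hb] at hy hy'
    grind
  have hstep : ∀ b b', M.arc z b → M.arc z b' → M.arc b b' → ¬ M.arc b a := by
    intro b b' hb hb' hbb hba
    have hbZ : M.arc b Z := (hZ b).1 hb
    have hbZ' : M.arc b' Z := (hZ b').1 hb'
    have hnab : ¬ M.arc a b' := fun h1 => hM.2 _ _ hb' ((h b').1 h1)
    have hne' : a ≠ b' := fun h1 => hadj _ _ h (h1 ▸ hb')
    rcases htour hba hbb hne' with h1 | h1
    · exact hnab h1
    · exact hne (htri' hbb hba hbZ h1 hbZ')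
  obtain ⟨b₀, b₁, b₂, hb, h01, h12, -⟩ := htri z
  have hb0 := (hb b₀).2 (.inl rfl)
  have hb1 := (hb b₁).2 (.inr (.inl rfl))
  have hb2 := (hb b₂).2 (.inr (.inr rfl))
  have hopp' : ∀ b, M.arc z b → ¬ M.arc b a → M.Opposite b a := by
    intro b hb hba
    refine (hind a b ?_ (fun h1 => hM.2 _ _ hb ((h b).1 h1)) hba).resolve_left fun h1 => ?_
    · rintro rfl
      exact hadj _ _ h hb
    · exact hM.ne hb (h.right_unique hM hout hind h1)
  exact hM.ne h01 ((hopp' _ hb0 (hstep _ _ hb0 hb1 h01)).left_unique hM hout hind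
    (hopp' _ hb1 (hstep _ _ hb1 hb2 h12)))

theorem iso_H0_of_triangles [Nonempty V] (hM : M.IsA)
    (htri : ∀ a, ∃ b₀ b₁ b₂, (∀ w, M.arc a w ↔ w = b₀ ∨ w = b₁ ∨ w = b₂) ∧
      M.arc b₀ b₁ ∧ M.arc b₁ b₂ ∧ M.arc b₂ b₀)
    (hopp : ∀ a, ∃ z, M.Opposite a z)
    (hind : ∀ u v, u ≠ v → ¬ M.arc u v → ¬ M.arc v u → M.Opposite u v ∨ M.Opposite v u)
    (hadj : ∀ u v, M.Opposite u v → ¬ M.arc v u) : M.Iso H0 := by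
  have hout : ∀ a, ∃ b, M.arc a b := fun a => by
    obtain ⟨b, _, _, hb, -⟩ := htri a
    exact ⟨b, (hb b).2 (.inl rfl)⟩
  have hsymm : ∀ {u v}, M.Opposite u v → M.Opposite v u := fun h =>
    h.symm_of_triangles hM htri hopp hind hadj
  choose z hz using hopp
  have hzz : ∀ u, z (z u) = u := fun u => (hz (z u)).right_unique hM hout hind (hsymm (hz u))
  have hleft : ∀ u v, M.arc (z u) v ↔ M.arc v u := fun u => hsymm (hz u)
  have hright : ∀ u v, M.arc u (z v) ↔ M.arc v u := fun u v => (hz v u).symm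
  obtain ⟨a⟩ := ‹Nonempty V›
  obtain ⟨b₀, b₁, b₂, hb, h01, h12, h20⟩ := htri a
  let p : Fin 4 → V := ![a, b₀, b₁, b₂]
  have hp : ∀ i j, M.arc (p i) (p j) ↔ H0.arc (signedVec (i, false)) (signedVec (j, false)) := by
    have hb0 := (hb b₀).2 (.inl rfl)
    have hb1 := (hb b₁).2 (.inr (.inl rfl))
    have hb2 := (hb b₂).2 (.inr (.inr rfl))
    intro i j
    have hT : ∀ {u v}, M.arc u v → ∀ {P : Prop}, P → (M.arc u v ↔ P) :=
      fun h _ => iff_of_true h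
    have hF : ∀ {u v}, M.arc u v → ∀ {P : Prop}, ¬ P → (M.arc v u ↔ P) := fun h _ =>
      iff_of_false (hM.2 _ _ h)
    fin_cases i <;> fin_cases j
    all_goals first
      | exact iff_of_false (hM.1 _) (by decide)
      | exact hT hb0 (by decide)
      | exact hT hb1 (by decide)
      | exact hT hb2 (by decide)
      | exact hT h01 (by decide)
      | exact hT h12 (by decide)
      | exact hT h20 (by decide)
      | exact hF hb0 (by decide)
      | exact hF hb1 (by decide)
      | exact hF hb2 (by decide)
      | exact hF h01 (by decide)
      | exact hF h12 (by decide)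
      | exact hF h20 (by decide)
  have hp0 : p 0 = a ∧ p 1 = b₀ ∧ p 2 = b₁ ∧ p 3 = b₂ := ⟨rfl, rfl, rfl, rfl⟩
  clear_value p
  let F : Fin 4 × Bool → V := fun x => bif x.2 then z (p x.1) else p x.1
  have hF : ∀ x y, M.arc (F x) (F y) ↔ H0.arc (signedVec x) (signedVec y) := by
    rintro ⟨i, _ | _⟩ ⟨j, _ | _⟩
    · exact hp i j
    · exact (hright _ _).trans ((hp j i).trans (arc_signedVec_not_right _ j false).symm)
    · exact (hleft _ _).trans ((hp j i).trans (arc_signedVec_not_left i false _).symm)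
    · exact (hleft _ _).trans ((hleft _ _).trans ((hp i j).trans
        ((arc_signedVec_not_left j false _).symm.trans (arc_signedVec_not_left i false _).symm)))
  have hinj : F.Injective := fun x y hxy => signedVec_ext x y fun w => by
    rw [← hF, ← hF, hxy]
  have hout' : ∀ v, M.arc a v → ∃ i, v = p i := fun v hv => by
    obtain ⟨-, h1, h2, h3⟩ := hp0
    rcases (hb v).1 hv with h | h | h
    · exact ⟨1, h.trans h1.symm⟩
    · exact ⟨2, h.trans h2.symm⟩
    · exact ⟨3, h.trans h3.symm⟩
  have hsurj : F.Surjective := fun v => by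
    by_cases h1 : v = a
    · exact ⟨(0, false), hp0.1.trans h1.symm⟩
    by_cases h2 : M.arc a v
    · obtain ⟨i, hi⟩ := hout' v h2
      exact ⟨(i, false), hi.symm⟩
    by_cases h3 : M.arc v a
    · obtain ⟨i, hi⟩ := hout' (z v) ((hright _ _).2 h3)
      exact ⟨(i, true), (congrArg z hi.symm).trans (hzz v)⟩
    · have h4 : M.Opposite a v := (hind a v (Ne.symm h1) h2 h3).elim id hsymm
      exact ⟨(0, true), (congrArg z hp0.1).trans ((hz a).right_unique hM hout hind h4)⟩
  let e := Equiv.ofBijective F ⟨hinj, hsurj⟩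
  refine ⟨e.symm.trans (Equiv.ofBijective _ signedVec_bijective), fun u v => ?_⟩
  have h := hF (e.symm u) (e.symm v)
  rwa [show F (e.symm u) = u from e.apply_symm_apply u,
    show F (e.symm v) = v from e.apply_symm_apply v] at h

end Octahedral

section Classification

variable {V W : Type*} {M : ADigraph V} {N : ADigraph W}

/-- `M` is one of the a-digraphs in the classification, up to isomorphism. -/
def IsStandard (M : ADigraph V) : Prop :=
  M.Iso (dirCycle 1) ∨ M.Iso (dirCycle 3) ∨ M.Iso (dirCycle 4) ∨
    M.Iso (dirCycle 5) ∨ M.Iso H0 ∨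
    ∃ n : ℕ, 1 ≤ n ∧
      (M.Iso (kbar n) ∨ M.Iso ((kbar n).comp (dirCycle 3)) ∨
        M.Iso ((dirCycle 3).comp (kbar n)))

theorem IsStandard.setHomogeneous (h : M.IsStandard) : M.SetHomogeneous := by
  rcases h with h | h | h | h | h | ⟨n, -, h | h | h⟩
  · exact setHomogeneous_dirCycle_one.of_iso h
  · exact setHomogeneous_dirCycle_three.of_iso h
  · exact setHomogeneous_dirCycle_four.of_iso h
  · exact setHomogeneous_dirCycle_five.of_iso h
  · exact homogeneous_H0.setHomogeneous.of_iso h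
  · exact (homogeneous_kbar n).setHomogeneous.of_iso h
  · exact (homogeneous_kbar_comp n).setHomogeneous.of_iso h
  · exact (homogeneous_comp_kbar n).setHomogeneous.of_iso h

theorem Iso.card_eq (h : M.Iso N) : Nat.card V = Nat.card W :=
  Nat.card_congr h.choose

theorem Iso.exists_arc (h : M.Iso N) (hM : ∃ u v, M.arc u v) : ∃ u v, N.arc u v := by
  obtain ⟨e, he⟩ := h
  obtain ⟨u, v, huv⟩ := hM
  exact ⟨_, _, (he u v).1 huv⟩

theorem Iso.exists_nonadjacent (h : M.Iso N) (hN : ∃ u v, u ≠ v ∧ ¬ N.arc u v ∧ ¬ N.arc v u) :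
    ∃ u v, u ≠ v ∧ ¬ M.arc u v ∧ ¬ M.arc v u := by
  obtain ⟨e, he⟩ := h.symm
  obtain ⟨u, v, huv, h1, h2⟩ := hN
  exact ⟨e u, e v, e.injective.ne huv, (he u v).not.1 h1, (he v u).not.1 h2⟩

instance (n : ℕ) : DecidableRel (dirCycle n).arc := fun _ _ => inferInstanceAs (Decidable (_ ∧ _))

theorem kbar_one_comp_iso (N : ADigraph W) : ((kbar 1).comp N).Iso N := by
  refine ⟨Equiv.uniqueProd W (Fin 1), ?_⟩
  rintro ⟨i, u⟩ ⟨j, v⟩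
  simp [comp, kbar, Subsingleton.elim i j]

theorem comp_kbar_one_iso (N : ADigraph W) : (N.comp (kbar 1)).Iso N := by
  refine ⟨Equiv.prodUnique W (Fin 1), ?_⟩
  rintro ⟨u, i⟩ ⟨v, j⟩
  simp [comp, kbar]

theorem outDeg_kbar_comp (n : ℕ) (x : Fin n × ZMod 3) :
    ((kbar n).comp (dirCycle 3)).outDeg x = 1 := by
  have h : ∀ i : ZMod 3, i ≠ i + 1 := by decide
  rw [outDeg, Nat.card_eq_one_iff_unique]
  refine ⟨⟨?_⟩, ⟨(x.1, x.2 + 1), .inr ⟨rfl, rfl, h _⟩⟩⟩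
  rintro ⟨u, hu⟩ ⟨v, hv⟩
  obtain ⟨hu1, hu2, -⟩ := hu.resolve_left id
  obtain ⟨hv1, hv2, -⟩ := hv.resolve_left id
  exact Subtype.ext (Prod.ext (hu1.symm.trans hv1) (hu2.trans hv2.symm))

theorem outDeg_comp_kbar (n : ℕ) (x : ZMod 3 × Fin n) :
    ((dirCycle 3).comp (kbar n)).outDeg x = n := by
  have h : ∀ i : ZMod 3, i ≠ i + 1 := by decide
  refine (Nat.card_congr (β := Fin n) ⟨fun v => v.1.2,
    fun i => ⟨(x.1 + 1, i), .inl ⟨rfl, h _⟩⟩, ?_, fun _ => rfl⟩).trans (Nat.card_fin n)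
  rintro ⟨⟨i, j⟩, hv⟩
  have hv : i = x.1 + 1 := (hv.resolve_right fun h => h.2).1
  exact Subtype.ext (Prod.ext hv.symm rfl)

theorem IsStandard.cases_of_arc (h : M.IsStandard) (hM : ∃ u v, M.arc u v) :
    (Nat.card V = 3 ∧ M.Iso (dirCycle 3)) ∨ (Nat.card V = 4 ∧ M.Iso (dirCycle 4)) ∨
    (Nat.card V = 5 ∧ M.Iso (dirCycle 5)) ∨ (Nat.card V = 8 ∧ M.Iso H0) ∨
    ∃ n, 2 ≤ n ∧ Nat.card V = 3 * n ∧
      (((∀ u, M.outDeg u = 1) ∧ M.Iso ((kbar n).comp (dirCycle 3))) ∨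
        ((∀ u, M.outDeg u = n) ∧ M.Iso ((dirCycle 3).comp (kbar n)))) := by
  have h8 : Nat.card {v : Fin 2 → ZMod 3 // v ≠ 0} = 8 := by
    rw [Nat.card_eq_fintype_card]
    decide +kernel
  have h1 : ¬ ∃ u v, (dirCycle 1).arc u v := by decide
  rcases h with h | h | h | h | h | ⟨n, hn, h⟩
  · exact (h1 (h.exists_arc hM)).elim
  · exact .inl ⟨h.card_eq.trans (Nat.card_zmod 3), h⟩
  · exact .inr (.inl ⟨h.card_eq.trans (Nat.card_zmod 4), h⟩)
  · exact .inr (.inr (.inl ⟨h.card_eq.trans (Nat.card_zmod 5), h⟩))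
  · exact .inr (.inr (.inr (.inl ⟨h.card_eq.trans h8, h⟩)))
  rcases h with h | h | h
  · obtain ⟨_, _, h⟩ := h.exists_arc hM
    exact h.elim
  · rcases eq_or_ne n 1 with rfl | hn1
    · have h := h.trans (kbar_one_comp_iso _)
      exact .inl ⟨h.card_eq.trans (Nat.card_zmod 3), h⟩
    · refine .inr (.inr (.inr (.inr ⟨n, by omega, ?_, .inl ⟨fun u => ?_, h⟩⟩)))
      · rw [h.card_eq, Nat.card_prod, Nat.card_fin, Nat.card_zmod, mul_comm]
      · obtain ⟨e, he⟩ := h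
        rw [← outDeg_iso e he, outDeg_kbar_comp]
  · rcases eq_or_ne n 1 with rfl | hn1
    · have h := h.trans (comp_kbar_one_iso _)
      exact .inl ⟨h.card_eq.trans (Nat.card_zmod 3), h⟩
    · refine .inr (.inr (.inr (.inr ⟨n, by omega, ?_, .inr ⟨fun u => ?_, h⟩⟩)))
      · rw [h.card_eq, Nat.card_prod, Nat.card_fin, Nat.card_zmod]
      · obtain ⟨e, he⟩ := h
        rw [← outDeg_iso e he, outDeg_comp_kbar]

/-- Standard a-digraphs with arcs are determined by their order and out-degree. -/
theorem IsStandard.iso (h : M.IsStandard) (h' : N.IsStandard) (hM : ∃ u v, M.arc u v)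
    (hN : ∃ u v, N.arc u v) (hcard : Nat.card V = Nat.card W)
    (hdeg : ∀ u v, M.outDeg u = N.outDeg v) : M.Iso N := by
  obtain ⟨u, -⟩ := id hM
  obtain ⟨v, -⟩ := id hN
  have hd := hdeg u v
  rcases h.cases_of_arc hM with
    ⟨hc, h⟩ | ⟨hc, h⟩ | ⟨hc, h⟩ | ⟨hc, h⟩ | ⟨n, hn, hc, ⟨ht, h⟩ | ⟨ht, h⟩⟩ <;>
  rcases h'.cases_of_arc hN with
    ⟨hc', h'⟩ | ⟨hc', h'⟩ | ⟨hc', h'⟩ | ⟨hc', h'⟩ | ⟨n', hn', hc', ⟨ht', h'⟩ | ⟨ht', h'⟩⟩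
  all_goals first
    | exact h.trans h'.symm
    | (exfalso; omega)
    | (exfalso; have := ht u; have := ht' v; omega)
    | (obtain rfl : n = n' := by omega
       exact h.trans h'.symm)

theorem IsStandard.iso_dirCycle_three (h : M.IsStandard) (hM : ∃ u v, M.arc u v)
    (hadj : ∀ u v, u ≠ v → M.arc u v ∨ M.arc v u) : M.Iso (dirCycle 3) := by
  have hnon : ∀ {W : Type} {N : ADigraph W} (u v : W), u ≠ v ∧ ¬ N.arc u v ∧ ¬ N.arc v u →
      ¬ M.Iso N := by
    intro W N u v huv h
    obtain ⟨u, v, huv, h1, h2⟩ := h.exists_nonadjacent ⟨u, v, huv⟩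
    exact (hadj u v huv).elim h1 h2
  rcases h.cases_of_arc hM with ⟨-, h⟩ | ⟨-, h⟩ | ⟨-, h⟩ | ⟨-, h⟩ | ⟨n, hn, -, ⟨-, h⟩ | ⟨-, h⟩⟩
  · exact h
  · exact (hnon 0 2 (by decide) h).elim
  · exact (hnon 0 2 (by decide) h).elim
  · exact (hnon (signedVec (0, false)) (signedVec (0, true)) (by decide +kernel) h).elim
  all_goals obtain ⟨m, rfl⟩ := Nat.exists_eq_add_of_le' hn
  · exact (hnon (0, 0) (1, 0) (by simp [comp, kbar]) h).elim
  · exact (hnon (0, 0) (0, 1) (by simp [comp, kbar, dirCycle]) h).elim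

end Classification

section Forward

variable {V : Type} {M : ADigraph V}

theorem SetHomogeneous.induce_out_iso_induce_in [Finite V] (hM : M.IsA) (hS : M.SetHomogeneous)
    {a b c : V} (hab : M.arc a b) (hac : M.arc a c) (hbc : M.arc b c)
    (hH : (M.induce {v | M.arc a v}).IsStandard) (hK : (M.induce {v | M.arc v c}).IsStandard) :
    (M.induce {v | M.arc a v}).Iso (M.induce {v | M.arc v c}) := by
  refine hH.iso hK ⟨⟨b, hab⟩, ⟨c, hac⟩, hbc⟩ ⟨⟨a, hac⟩, ⟨b, hbc⟩, hab⟩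
    (hS.outDeg_rev hM c a).symm fun u v => ?_
  rw [(hS.induce_in hM c).outDeg_eq (hM.induce _) v ⟨a, hac⟩,
    ← (hS.induce_out hM a).outDeg_rev (hM.induce _) ⟨c, hac⟩ u]
  exact Nat.card_congr ⟨fun x => ⟨⟨x.1.1, x.2⟩, x.1.2⟩, fun x => ⟨⟨x.1.1, x.2⟩, x.1.2⟩,
    fun _ => rfl, fun _ => rfl⟩

theorem SetHomogeneous.iso_H0_of_iso [Finite V] (hM : M.IsA) (hS : M.SetHomogeneous)
    {a b c : V} (hab : M.arc a b) (hac : M.arc a c) (hbc : M.arc b c)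
    (hH : (M.induce {v | M.arc a v}).IsStandard)
    (h : (M.induce {v | M.arc a v}).Iso (M.induce {v | M.arc v c})) : M.Iso H0 := by
  have : Nonempty V := ⟨a⟩
  have hnot : ¬ ∀ u v, M.arc u v → M.Opposite v u := fun h =>
    hM.2 _ _ hac ((h _ _ hab c).1 hbc)
  obtain ⟨z, hz⟩ := hS.exists_opposite h
  obtain ⟨-, hind⟩ := (hS.opposite_cases hM hab hz).resolve_left hnot
  have htri : (M.induce {v | M.arc a v}).Iso (dirCycle 3) := by
    refine hH.iso_dirCycle_three ⟨⟨b, hab⟩, ⟨c, hac⟩, hbc⟩ fun u v huv => ?_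
    by_contra! hn
    rcases hind u v (Subtype.coe_injective.ne huv) hn.1 hn.2 with h | h
    · exact not_opposite_of_common_in hM u.2 v.2 h
    · exact not_opposite_of_common_in hM v.2 u.2 h
  have htri : ∀ a, ∃ b₀ b₁ b₂, (∀ w, M.arc a w ↔ w = b₀ ∨ w = b₁ ∨ w = b₂) ∧
      M.arc b₀ b₁ ∧ M.arc b₁ b₂ ∧ M.arc b₂ b₀ := by
    intro u
    obtain ⟨g, hg, rfl⟩ := hS.exists_auto_vertex hM a u
    obtain ⟨e, he⟩ := htri.symm
    refine ⟨g (e 0), g (e 1), g (e 2), fun w => ⟨fun hw => ?_, ?_⟩, (hg _ _).1 ((he 0 1).1 ?_),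
      (hg _ _).1 ((he 1 2).1 ?_), (hg _ _).1 ((he 2 0).1 ?_)⟩
    · have hw : M.arc a (g.symm w) := by rwa [hg, g.apply_symm_apply]
      have h3 : ∀ i : ZMod 3, i = 0 ∨ i = 1 ∨ i = 2 := by decide
      have hw' : ∀ i, e.symm ⟨_, hw⟩ = i → w = g (e i) := by
        rintro _ rfl
        simp
      exact (h3 (e.symm ⟨_, hw⟩)).imp (hw' _) (Or.imp (hw' _) (hw' _))
    · rintro (rfl | rfl | rfl) <;> exact (hg _ _).1 (e _).2
    all_goals decide
  refine iso_H0_of_triangles hM htri (fun u => ?_) hind fun u v huv => ?_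
  · obtain ⟨g, hg, rfl⟩ := hS.exists_auto_vertex hM a u
    exact ⟨g z, hg.opposite hz⟩
  · obtain ⟨w, _, _, hw, -⟩ := htri u
    exact ((hS.opposite_cases hM ((hw w).2 (.inl rfl)) huv).resolve_left hnot).1

theorem SetHomogeneous.isStandard (n : ℕ) : ∀ {V : Type} [Finite V] [Nonempty V] {M : ADigraph V},
    Nat.card V = n → M.IsA → M.SetHomogeneous → M.IsStandard := by
  induction n using Nat.strong_induction_on with
  | _ n ih =>
  intro V _ hne M hcard hM hS
  by_cases hT : ∃ a b c, M.arc a b ∧ M.arc a c ∧ M.arc b c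
  · obtain ⟨a, b, c, hab, hac, hbc⟩ := hT
    have : Nonempty {v | M.arc a v} := ⟨⟨b, hab⟩⟩
    have : Nonempty {v | M.arc v c} := ⟨⟨b, hbc⟩⟩
    have hH := ih _ (hcard ▸ Finite.card_subtype_lt (hM.1 a)) rfl (hM.induce _)
      (hS.induce_out hM a)
    have hK := ih _ (hcard ▸ Finite.card_subtype_lt (hM.1 c)) rfl (hM.induce _)
      (hS.induce_in hM c)
    exact .inr (.inr (.inr (.inr (.inl (hS.iso_H0_of_iso hM hab hac hbc hH
      (hS.induce_out_iso_induce_in hM hab hac hbc hH hK))))))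
  push Not at hT
  obtain ⟨a⟩ := id hne
  have hdeg := fun u => hS.outDeg_eq hM u a
  rcases lt_trichotomy (M.outDeg a) 1 with h | h | h
  · refine .inr (.inr (.inr (.inr (.inr ⟨Nat.card V, Nat.card_pos,
      .inl (iso_kbar fun u v huv => ?_)⟩))))
    have : Nonempty {v // M.arc u v} := ⟨⟨v, huv⟩⟩
    have : 0 < M.outDeg u := Nat.card_pos
    have := hdeg u
    omega
  · rcases hS.iso_of_outDeg_eq_one hM fun u => (hdeg u).trans h with h | h | ⟨m, h⟩
    · exact .inr (.inr (.inl h))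
    · exact .inr (.inr (.inr (.inl h)))
    · refine .inr (.inr (.inr (.inr (.inr ⟨m, ?_, .inr (.inl h)⟩))))
      exact Fin.pos (h.choose a).1
  · exact .inr (.inr (.inr (.inr (.inr ⟨_, h.le, .inr (.inr
      (hS.iso_of_transitive_free hM hT h hdeg))⟩))))

end Forward

end ADigraph

open ADigraph

/-- A finite a-digraph is set-homogeneous iff it is
isomorphic to one of `D₁`, `D₃`, `D₄`, `D₅`, `H₀`, `K̄_n`, `K̄_n[D₃]`,
`D₃[K̄_n]` for some `n ≥ 1`. -/
theorem finite_set_homogeneous_adigraph_classification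
    {V : Type} [Fintype V] [Nonempty V] (M : ADigraph V) (hM : M.IsA) :
    M.SetHomogeneous ↔
      (M.Iso (dirCycle 1) ∨ M.Iso (dirCycle 3) ∨ M.Iso (dirCycle 4) ∨
        M.Iso (dirCycle 5) ∨ M.Iso H0 ∨
        ∃ n : ℕ, 1 ≤ n ∧
          (M.Iso (kbar n) ∨ M.Iso ((kbar n).comp (dirCycle 3)) ∨
            M.Iso ((dirCycle 3).comp (kbar n)))) :=
  ⟨fun hS => hS.isStandard _ rfl hM, fun h => IsStandard.setHomogeneous h⟩
end

section
/- Let M be a finite set-homogeneous s-digraph which is not Γ-connected. Then M or its complement M̄ is isomorphic to one of: K_n[A] for some finite set-homogeneous a-digraph A and some n > 1; L for some finite set-homogeneous graph L; L[D_3] for some finite set-homogeneous graph L; or F_6. -/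
/-- A symmetric digraph (s-digraph): an arc relation and an edge relation on
the vertex type. -/
structure SDigraph (V : Type*) where
  arc : V → V → Prop
  edge : V → V → Prop

namespace SDigraph

variable {V W : Type*}

/-- The s-digraph axioms: arcs are irreflexive and antisymmetric, edges are
irreflexive and symmetric, and no pair of vertices is related by both. -/
def IsS (M : SDigraph V) : Prop :=
  (∀ v, ¬ M.arc v v) ∧ (∀ u v, M.arc u v → ¬ M.arc v u) ∧
    (∀ v, ¬ M.edge v v) ∧ (∀ u v, M.edge u v → M.edge v u) ∧
    ∀ u v, M.edge u v → ¬ M.arc u v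

/-- An s-digraph with no arcs is a graph. -/
def NoArcs (M : SDigraph V) : Prop := ∀ u v, ¬ M.arc u v

/-- An s-digraph with no edges is an a-digraph. -/
def NoEdges (M : SDigraph V) : Prop := ∀ u v, ¬ M.edge u v

/-- Isomorphism of s-digraphs. -/
def Iso (M : SDigraph V) (N : SDigraph W) : Prop :=
  ∃ e : V ≃ W, (∀ u v, M.arc u v ↔ N.arc (e u) (e v)) ∧
    ∀ u v, M.edge u v ↔ N.edge (e u) (e v)

/-- Induced sub-s-digraph on a set of vertices. -/
def induce (M : SDigraph V) (S : Set V) : SDigraph S :=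
  ⟨fun u v => M.arc (u : V) (v : V), fun u v => M.edge (u : V) (v : V)⟩

/-- `g` is an automorphism of `M`. -/
def IsAuto (M : SDigraph V) (g : V ≃ V) : Prop :=
  (∀ u v, M.arc u v ↔ M.arc (g u) (g v)) ∧
    ∀ u v, M.edge u v ↔ M.edge (g u) (g v)

/-- `M` is set-homogeneous: whenever two finite sets of vertices induce
isomorphic sub-s-digraphs, some automorphism maps one set onto the other. -/
def SetHomogeneous (M : SDigraph V) : Prop :=
  ∀ U U' : Set V, U.Finite → U'.Finite → (M.induce U).Iso (M.induce U') →
    ∃ g : V ≃ V, M.IsAuto g ∧ ⇑g '' U = U'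

/-- The complement of an s-digraph: arcs are reversed, and edges are
interchanged with unrelated pairs. -/
def compl (M : SDigraph V) : SDigraph V :=
  ⟨fun u v => M.arc v u,
   fun u v => u ≠ v ∧ ¬ M.edge u v ∧ ¬ M.arc u v ∧ ¬ M.arc v u⟩

/-- The compositional product `M[N]`. -/
def comp (M : SDigraph V) (N : SDigraph W) : SDigraph (V × W) :=
  ⟨fun p q => M.arc p.1 q.1 ∨ (p.1 = q.1 ∧ N.arc p.2 q.2),
   fun p q => M.edge p.1 q.1 ∨ (p.1 = q.1 ∧ N.edge p.2 q.2)⟩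

/-- Γ-connectedness: any two vertices are joined by a path of arcs
(ignoring orientation, and not using edges). -/
def GammaConnected (M : SDigraph V) : Prop :=
  ∀ u v : V, Relation.ReflTransGen (fun a b => M.arc a b ∨ M.arc b a) u v

/-- The complete graph `K_n`, as an s-digraph. -/
def K (n : ℕ) : SDigraph (Fin n) :=
  ⟨fun _ _ => False, fun i j => i ≠ j⟩

/-- The directed triangle `D₃`, as an s-digraph. -/
def D3 : SDigraph (ZMod 3) :=
  ⟨fun i j => j = i + 1, fun _ _ => False⟩

/-- The s-digraph `E₆`: a directed 6-cycle with edges between opposite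
vertices. -/
def E6 : SDigraph (ZMod 6) :=
  ⟨fun i j => j = i + 1, fun i j => j = i + 3 ∨ i = j + 3⟩

/-- The s-digraph `E₇`: a directed 7-cycle with edges `i ∼ i + 3`. -/
def E7 : SDigraph (ZMod 7) :=
  ⟨fun i j => j = i + 1, fun i j => j = i + 3 ∨ i = j + 3⟩

/-- The s-digraph `F₆`: two directed triangles matched by edges. -/
def F6 : SDigraph (Fin 2 × ZMod 3) :=
  ⟨fun p q => p.1 = q.1 ∧ q.2 = p.2 + 1,
   fun p q => p.1 ≠ q.1 ∧ p.2 = q.2⟩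

/-- The s-digraph `J_n`: three independent `n`-element blocks `B₀, B₁, B₂`
with all arcs from `B_i` to `B_{i+1}` except along the matchings, where
there are edges instead. -/
def J (n : ℕ) : SDigraph (ZMod 3 × Fin n) :=
  ⟨fun p q => q.1 = p.1 + 1 ∧ p.2 ≠ q.2,
   fun p q => p.1 ≠ q.1 ∧ p.2 = q.2⟩

/-- The s-digraph `H₁` on 8 vertices (vertices `0`–`7` here standing for
`1`–`8`). -/
def H1 : SDigraph (Fin 8) :=
  ⟨fun p q => (p, q) ∈
      ([(0, 2), (0, 5), (1, 3), (1, 4), (2, 1), (2, 6), (3, 0), (3, 7),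
        (4, 0), (4, 6), (5, 1), (5, 7), (6, 3), (6, 5), (7, 2), (7, 4)] :
        List (Fin 8 × Fin 8)),
   fun p q => (p, q) ∈
      ([(0, 1), (1, 0), (2, 3), (3, 2), (4, 5), (5, 4), (6, 7), (7, 6)] :
        List (Fin 8 × Fin 8))⟩

/-- The mate of a vertex of `H₂` (the unique vertex joined to it by an
edge). -/
def mate (v : Fin 12) : Fin 12 :=
  if v.val % 2 = 0 then v + 1 else v - 1

/-- The twelve basic arcs of `H₂` (vertices `0`–`11` standing for `1`–`12`). -/
def H2Base : List (Fin 12 × Fin 12) :=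
  [(0, 11), (0, 9), (1, 4), (2, 1), (3, 4), (3, 6),
   (5, 6), (7, 8), (8, 5), (10, 7), (10, 9), (11, 2)]

/-- The arcs of `H₂`: the closure of the basic arcs under the rules
"if `v → w` then `w → v′`" and "if `w → v` then `v′ → w`", where `v′` denotes
the mate of `v`. -/
inductive H2Arc : Fin 12 → Fin 12 → Prop
  | base (p q : Fin 12) : (p, q) ∈ H2Base → H2Arc p q
  | fwd (p q : Fin 12) : H2Arc p q → H2Arc q (mate p)
  | bwd (p q : Fin 12) : H2Arc p q → H2Arc (mate q) p

/-- The s-digraph `H₂` on 12 vertices. -/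
def H2 : SDigraph (Fin 12) :=
  ⟨H2Arc, fun p q => q = mate p⟩

/-- The s-digraph `H₃` on the 27 vertices `GF(3)² × GF(3)`: an edge
`(u,α) ∼ (v,β)` iff `u = v` and `α ≠ β`, and an arc `(u,α) → (v,β)` iff
`u ≠ v` and `det(uᵀ vᵀ) = α - β + 1`. -/
def H3 : SDigraph ((Fin 2 → ZMod 3) × ZMod 3) :=
  ⟨fun p q => p.1 ≠ q.1 ∧ p.1 0 * q.1 1 - p.1 1 * q.1 0 = p.2 - q.2 + 1,
   fun p q => p.1 = q.1 ∧ p.2 ≠ q.2⟩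

end SDigraph

open SDigraph

/-- The possible outcomes in Lemma 3.2(ii): `K_n[A]` with `n > 1`, a graph
`L`, `L[D₃]`, or `F₆`. -/
def InListDisconnected {V : Type} (N : SDigraph V) : Prop :=
  (∃ n : ℕ, 1 < n ∧ ∃ (At : Type) (_ : Fintype At) (A : SDigraph At),
      A.IsS ∧ A.NoEdges ∧ A.SetHomogeneous ∧ N.Iso ((K n).comp A)) ∨
  (∃ (Lt : Type) (_ : Fintype Lt) (L : SDigraph Lt),
      L.IsS ∧ L.NoArcs ∧ L.SetHomogeneous ∧
        (N.Iso L ∨ N.Iso (L.comp D3))) ∨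
  N.Iso F6


namespace SDigraph

section Automorphisms

variable {V : Type*} {M : SDigraph V}

theorem IsAuto.refl (M : SDigraph V) : M.IsAuto (Equiv.refl V) :=
  ⟨fun _ _ => Iff.rfl, fun _ _ => Iff.rfl⟩

theorem IsAuto.symm {g : V ≃ V} (hg : M.IsAuto g) : M.IsAuto g.symm :=
  ⟨fun u v => by simpa using (hg.1 (g.symm u) (g.symm v)).symm,
    fun u v => by simpa using (hg.2 (g.symm u) (g.symm v)).symm⟩

theorem IsAuto.trans {g h : V ≃ V} (hg : M.IsAuto g) (hh : M.IsAuto h) :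
    M.IsAuto (g.trans h) :=
  ⟨fun u v => (hg.1 u v).trans (hh.1 _ _), fun u v => (hg.2 u v).trans (hh.2 _ _)⟩

/-- Set-homogeneity for sets given by injective enumerations of the same pattern. -/
theorem SetHomogeneous.exists_auto_image_range (h : M.SetHomogeneous) {n : ℕ}
    {f f' : Fin n → V} (hf : f.Injective) (hf' : f'.Injective)
    (harc : ∀ i j, M.arc (f i) (f j) ↔ M.arc (f' i) (f' j))
    (hedge : ∀ i j, M.edge (f i) (f j) ↔ M.edge (f' i) (f' j)) :
    ∃ g : V ≃ V, M.IsAuto g ∧ ⇑g '' Set.range f = Set.range f' := by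
  refine h _ _ (Set.finite_range f) (Set.finite_range f')
    ⟨(Equiv.ofInjective f hf).symm.trans (Equiv.ofInjective f' hf'), ?_, ?_⟩
  · rintro ⟨_, i, rfl⟩ ⟨_, j, rfl⟩
    simpa [induce, Equiv.ofInjective_symm_apply hf] using harc i j
  · rintro ⟨_, i, rfl⟩ ⟨_, j, rfl⟩
    simpa [induce, Equiv.ofInjective_symm_apply hf] using hedge i j

theorem SetHomogeneous.exists_auto_apply (h : M.SetHomogeneous) (hM : M.IsS) (u v : V) :
    ∃ g : V ≃ V, M.IsAuto g ∧ g u = v := by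
  obtain ⟨g, hg, hgi⟩ := h.exists_auto_image_range (f := ![u]) (f' := ![v])
    (Function.injective_of_subsingleton _) (Function.injective_of_subsingleton _)
    (by simp [hM.1]) (by simp [hM.2.2.1])
  exact ⟨g, hg, by simpa using hgi⟩

theorem SetHomogeneous.exists_auto_pair (h : M.SetHomogeneous) (hM : M.IsS) {u v u' v' : V}
    (huv : u ≠ v) (huv' : u' ≠ v') (h₁ : M.arc u v ↔ M.arc u' v')
    (h₂ : M.arc v u ↔ M.arc v' u') (h₃ : M.edge u v ↔ M.edge u' v') :
    ∃ g : V ≃ V, M.IsAuto g ∧ ((g u = u' ∧ g v = v') ∨ (g u = v' ∧ g v = u')) := by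
  have hs : ∀ a b, M.edge a b ↔ M.edge b a := fun a b => ⟨hM.2.2.2.1 a b, hM.2.2.2.1 b a⟩
  obtain ⟨g, hg, hgi⟩ := h.exists_auto_image_range (f := ![u, v]) (f' := ![u', v'])
    (by intro i j; fin_cases i <;> fin_cases j <;> simp [huv, huv.symm])
    (by intro i j; fin_cases i <;> fin_cases j <;> simp [huv', huv'.symm])
    (by intro i j; fin_cases i <;> fin_cases j <;> simp [hM.1, h₁, h₂])
    (by intro i j; fin_cases i <;> fin_cases j <;> simp [hM.2.2.1, h₃, hs v u, hs v' u'])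
  refine ⟨g, hg, ?_⟩
  have hu : g u ∈ Set.range ![u', v'] := hgi ▸ ⟨u, ⟨0, rfl⟩, rfl⟩
  have hv : g v ∈ Set.range ![u', v'] := hgi ▸ ⟨v, ⟨1, rfl⟩, rfl⟩
  have hne : g u ≠ g v := g.injective.ne huv
  simp only [Matrix.range_cons, Matrix.range_empty, Set.union_empty, Set.mem_union,
    Set.mem_singleton_iff] at hu hv
  grind

end Automorphisms

section Complement

variable {V : Type*} {M : SDigraph V}

theorem IsS.compl (hM : M.IsS) : M.compl.IsS := by
  obtain ⟨h₁, h₂, h₃, h₄, h₅⟩ := hM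
  simp only [IsS, SDigraph.compl]
  grind

theorem compl_edge_iff_of_iso_fun {W : Type*} {N : SDigraph W} {e : V → W} (he : e.Injective)
    (harc : ∀ u v, M.arc u v ↔ N.arc (e u) (e v))
    (hedge : ∀ u v, M.edge u v ↔ N.edge (e u) (e v)) (u v : V) :
    M.compl.edge u v ↔ N.compl.edge (e u) (e v) := by
  simp [compl, ← harc, ← hedge, he.ne_iff]

theorem IsS.edge_iff_compl (hM : M.IsS) (u v : V) : M.edge u v ↔
    u ≠ v ∧ ¬ M.compl.edge u v ∧ ¬ M.compl.arc u v ∧ ¬ M.compl.arc v u := by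
  obtain ⟨h₁, h₂, h₃, h₄, h₅⟩ := hM
  simp only [SDigraph.compl]
  grind

theorem IsAuto.compl {g : V ≃ V} (hg : M.IsAuto g) : M.compl.IsAuto g :=
  ⟨fun u v => hg.1 v u, compl_edge_iff_of_iso_fun g.injective hg.1 hg.2⟩

theorem IsS.induce (hM : M.IsS) (S : Set V) : (M.induce S).IsS :=
  ⟨fun v => hM.1 v, fun u v => hM.2.1 u v, fun v => hM.2.2.1 v, fun u v => hM.2.2.2.1 u v,
    fun u v => hM.2.2.2.2 u v⟩

theorem SetHomogeneous.compl (h : M.SetHomogeneous) (hM : M.IsS) : M.compl.SetHomogeneous := by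
  rintro U U' hU hU' ⟨e, he₁, he₂⟩
  change ∀ u v : U, M.compl.arc u v ↔ M.compl.arc (e u) (e v) at he₁
  change ∀ u v : U, M.compl.edge u v ↔ M.compl.edge (e u) (e v) at he₂
  have he₃ (u v : U) : M.edge u v ↔ M.edge (e u) (e v) := by
    have h₃ : (e u : V) = e v ↔ (u : V) = v := by simp [Subtype.coe_inj]
    rw [hM.edge_iff_compl u v, hM.edge_iff_compl (e u) (e v), he₁, he₁, he₂, Ne, Ne, h₃]
  obtain ⟨g, hg, hgU⟩ := h U U' hU hU' ⟨e, fun u v => he₁ v u, he₃⟩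
  exact ⟨g, hg.compl, hgU⟩

end Complement

section Components

variable {V : Type*} {M : SDigraph V}

/-- Two vertices lie in the same Γ-component. -/
def Reach (M : SDigraph V) : V → V → Prop :=
  Relation.ReflTransGen (fun a b => M.arc a b ∨ M.arc b a)

theorem Reach.refl (M : SDigraph V) (u : V) : M.Reach u u := Relation.ReflTransGen.refl

theorem Reach.symm {u v : V} (h : M.Reach u v) : M.Reach v u :=
  have : Std.Symm fun a b => M.arc a b ∨ M.arc b a := ⟨fun _ _ => Or.symm⟩
  Relation.ReflTransGen.stdSymm.symm _ _ h

theorem Reach.trans {u v w : V} (h : M.Reach u v) (h' : M.Reach v w) : M.Reach u w :=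
  Relation.ReflTransGen.trans h h'

theorem reach_of_arc {u v : V} (h : M.arc u v) : M.Reach u v :=
  Relation.ReflTransGen.single (Or.inl h)

/-- The Γ-components as a quotient. -/
def reachSetoid (M : SDigraph V) : Setoid V :=
  ⟨M.Reach, Reach.refl M, Reach.symm, Reach.trans⟩

theorem reach_compl : M.compl.Reach = M.Reach := by
  unfold Reach
  congr 1
  funext a b
  simp [compl, or_comm]

theorem Reach.map {g : V ≃ V} (hg : M.IsAuto g) {u v : V} (h : M.Reach u v) :
    M.Reach (g u) (g v) :=
  Relation.ReflTransGen.lift g (fun a b hab => by simpa [Function.onFun, ← hg.1] using hab) _ _ h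

theorem IsAuto.reach_iff {g : V ≃ V} (hg : M.IsAuto g) {u v : V} :
    M.Reach (g u) (g v) ↔ M.Reach u v :=
  ⟨fun h => by simpa using h.map hg.symm, Reach.map hg⟩

/-- A Γ-component of a set-homogeneous s-digraph is set-homogeneous. -/
theorem SetHomogeneous.induce_reach (h : M.SetHomogeneous) (v₀ : V) :
    (M.induce {v | M.Reach v₀ v}).SetHomogeneous := by
  rintro U U' hU hU' ⟨e, he₁, he₂⟩
  rcases U.eq_empty_or_nonempty with rfl | ⟨u₀, hu₀⟩
  · refine ⟨Equiv.refl _, IsAuto.refl _, ?_⟩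
    rcases U'.eq_empty_or_nonempty with rfl | ⟨u', hu'⟩
    · simp
    · exact (e.symm ⟨u', hu'⟩).2.elim
  · let i := Equiv.Set.image Subtype.val U Subtype.val_injective
    let i' := Equiv.Set.image Subtype.val U' Subtype.val_injective
    have hi : ∀ u, ((i.symm u : {v | M.Reach v₀ v}) : V) = u := fun u =>
      congrArg Subtype.val (i.apply_symm_apply u)
    have hiso : (M.induce (Subtype.val '' U)).Iso (M.induce (Subtype.val '' U')) := by
      refine ⟨i.symm.trans (e.trans i'), fun u v => ?_, fun u v => ?_⟩
      · have := he₁ (i.symm u) (i.symm v)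
        change M.arc (i.symm u).1 (i.symm v).1 ↔ _ at this
        rw [hi, hi] at this
        exact this
      · have := he₂ (i.symm u) (i.symm v)
        change M.edge (i.symm u).1 (i.symm v).1 ↔ _ at this
        rw [hi, hi] at this
        exact this
    obtain ⟨g, hg, hgU⟩ := h (Subtype.val '' U) (Subtype.val '' U') (hU.image _) (hU'.image _) hiso
    have hg₀ : M.Reach v₀ (g u₀) := by
      have : g u₀ ∈ Subtype.val '' U' := hgU ▸ ⟨u₀, ⟨u₀, hu₀, rfl⟩, rfl⟩
      obtain ⟨w, -, hw⟩ := this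
      exact hw ▸ w.2
    have hgC : ∀ v, v ∈ {v | M.Reach v₀ v} ↔ g v ∈ {v | M.Reach v₀ v} := fun v =>
      ⟨fun hv => hg₀.trans ((u₀.2.symm.trans hv).map hg),
        fun hv => u₀.2.trans (hg.reach_iff.1 (hg₀.symm.trans hv))⟩
    refine ⟨g.subtypeEquiv hgC, ⟨fun u v => hg.1 u v, fun u v => hg.2 u v⟩, ?_⟩
    apply Set.image_injective.2 Subtype.val_injective
    rw [← hgU, Set.image_image, Set.image_image]
    rfl

end Components

end SDigraph

namespace SDigraph

section Tournaments

variable {V : Type*} {M : SDigraph V}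

/-- Any two distinct vertices are joined by an arc. -/
def IsTournament (M : SDigraph V) : Prop :=
  ∀ u v, u ≠ v → M.arc u v ∨ M.arc v u

/-- The automorphism group of an s-digraph. -/
def autSubgroup (M : SDigraph V) : Subgroup (Equiv.Perm V) where
  carrier := {g | M.IsAuto g}
  mul_mem' := fun ha hb => hb.trans ha
  one_mem' := IsAuto.refl M
  inv_mem' := fun ha => ha.symm

theorem IsTournament.odd_card_autSubgroup [Finite V] (hT : M.IsTournament) (hM : M.IsS) :
    Odd (Nat.card M.autSubgroup) := by
  rw [← Nat.not_even_iff_odd, even_iff_two_dvd]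
  intro h2
  obtain ⟨g, hg⟩ := exists_prime_orderOf_dvd_card' 2 h2
  have hgg : ∀ x, g.1 (g.1 x) = x := fun x => by
    have := pow_orderOf_eq_one g
    rw [hg, pow_two] at this
    exact DFunLike.congr_fun (congrArg Subtype.val this) x
  have hg1 : g = 1 := by
    ext x
    by_contra hx
    have hx : x ≠ g.1 x := fun h => hx h.symm
    rcases hT _ _ hx with h | h
    · have := (g.2.1 _ _).1 h
      rw [hgg] at this
      exact hM.2.1 _ _ h this
    · have := (g.2.1 _ _).1 h
      rw [hgg] at this
      exact hM.2.1 _ _ h this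
  rw [hg1, orderOf_one] at hg
  omega

open scoped Pointwise in
/-- A family of subsets of a tournament permuted transitively by the automorphisms has odd size. -/
theorem IsTournament.odd_card_of_isOrbit [Finite V] [DecidableEq V] (hT : M.IsTournament)
    (hM : M.IsS) {S : Finset (Finset V)} {U : Finset V}
    (hmap : ∀ g : V ≃ V, M.IsAuto g → U.image g ∈ S)
    (htrans : ∀ U' ∈ S, ∃ g : V ≃ V, M.IsAuto g ∧ g '' (U : Set V) = U') : Odd S.card := by
  have horb : MulAction.orbit M.autSubgroup U = (S : Set (Finset V)) := by
    ext U'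
    constructor
    · rintro ⟨g, rfl⟩
      exact hmap g.1 g.2
    · intro hU'
      obtain ⟨g, hg, hgU⟩ := htrans U' hU'
      refine ⟨⟨g, hg⟩, ?_⟩
      apply Finset.coe_injective
      rw [← hgU]
      exact Finset.coe_image
  have hdvd : S.card ∣ Nat.card M.autSubgroup := by
    rw [← Set.ncard_coe_finset S, ← horb, ← MulAction.index_stabilizer]
    exact Subgroup.index_dvd_card _
  exact (hT.odd_card_autSubgroup hM).of_dvd_nat hdvd

/-- A three-vertex tournament has a Hamiltonian path. -/
theorem IsTournament.exists_path_of_card_eq_three [DecidableEq V] (hT : M.IsTournament)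
    {U : Finset V} (hU : U.card = 3) : ∃ a b c, a ≠ b ∧ a ≠ c ∧ b ≠ c ∧ U = {a, b, c} ∧
      M.arc a b ∧ M.arc b c := by
  obtain ⟨a, b, c, hab, hac, hbc, rfl⟩ := Finset.card_eq_three.1 hU
  have h₁ : ({a, b, c} : Finset V) = {a, c, b} := by ext; simp; tauto
  have h₂ : ({a, b, c} : Finset V) = {b, a, c} := by ext; simp; tauto
  have h₃ : ({a, b, c} : Finset V) = {b, c, a} := by ext; simp; tauto
  have h₄ : ({a, b, c} : Finset V) = {c, a, b} := by ext; simp; tauto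
  have h₅ : ({a, b, c} : Finset V) = {c, b, a} := by ext; simp; tauto
  have hs : M.arc a b ∧ M.arc b c ∨ M.arc a c ∧ M.arc c b ∨ M.arc b a ∧ M.arc a c ∨
      M.arc b c ∧ M.arc c a ∨ M.arc c a ∧ M.arc a b ∨ M.arc c b ∧ M.arc b a := by
    have := hT a b hab
    have := hT a c hac
    have := hT b c hbc
    tauto
  rcases hs with h | h | h | h | h | h
  · exact ⟨a, b, c, hab, hac, hbc, rfl, h⟩
  · exact ⟨a, c, b, hac, hab, hbc.symm, h₁, h⟩
  · exact ⟨b, a, c, hab.symm, hbc, hac, h₂, h⟩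
  · exact ⟨b, c, a, hbc, hab.symm, hac.symm, h₃, h⟩
  · exact ⟨c, a, b, hac.symm, hbc.symm, hab, h₄, h⟩
  · exact ⟨c, b, a, hbc.symm, hac.symm, hab.symm, h₅, h⟩

/-- A set of vertices with a vertex dominating all the others. -/
def HasSource (M : SDigraph V) (U : Finset V) : Prop :=
  ∃ a ∈ U, ∀ b ∈ U, a ≠ b → M.arc a b

theorem hasSource_iff_of_path [DecidableEq V] (hM : M.IsS) {a b c : V}
    (hab : M.arc a b) (hbc : M.arc b c) (hac : a ≠ c) :
    M.HasSource {a, b, c} ↔ M.arc a c := by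
  have h₁ := hM.1
  have h₂ := hM.2.1
  simp only [HasSource, Finset.mem_insert, Finset.mem_singleton]
  constructor
  · rintro ⟨x, rfl | rfl | rfl, hx⟩
    · exact hx c (by simp) hac
    · exact absurd (hx a (by simp) (by rintro rfl; exact h₁ _ hab)) (h₂ _ _ hab)
    · exact absurd (hx b (by simp) (by rintro rfl; exact h₁ _ hbc)) (h₂ _ _ hbc)
  · intro h
    exact ⟨a, by simp, by rintro x (rfl | rfl | rfl) hx <;> tauto⟩

theorem HasSource.image [DecidableEq V] {g : V ≃ V} (hg : M.IsAuto g) {U : Finset V}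
    (h : M.HasSource U) : M.HasSource (U.image g) := by
  obtain ⟨a, ha, h⟩ := h
  refine ⟨g a, Finset.mem_image_of_mem g ha, ?_⟩
  intro b hb hab
  obtain ⟨c, hc, rfl⟩ := Finset.mem_image.1 hb
  exact (hg.1 _ _).1 (h c hc (fun h => hab (h ▸ rfl)))

theorem hasSource_image_iff [DecidableEq V] {g : V ≃ V} (hg : M.IsAuto g) {U : Finset V} :
    M.HasSource (U.image g) ↔ M.HasSource U := by
  refine ⟨fun h => ?_, HasSource.image hg⟩
  simpa [Finset.image_image] using h.image hg.symm

theorem IsTournament.noEdges (hT : M.IsTournament) (hM : M.IsS) : M.NoEdges := by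
  intro u v huv
  rcases hT u v (by rintro rfl; exact hM.2.2.1 _ huv) with h | h
  · exact hM.2.2.2.2 _ _ huv h
  · exact hM.2.2.2.2 _ _ (hM.2.2.2.1 _ _ huv) h

theorem IsTournament.exists_auto_of_hasSource_iff [DecidableEq V] (hT : M.IsTournament)
    (hM : M.IsS) (h : M.SetHomogeneous) {U U' : Finset V} (hU : U.card = 3) (hU' : U'.card = 3)
    (hUU' : M.HasSource U ↔ M.HasSource U') :
    ∃ g : V ≃ V, M.IsAuto g ∧ g '' (U : Set V) = U' := by
  obtain ⟨a, b, c, hab, hac, hbc, rfl, h₁, h₂⟩ := hT.exists_path_of_card_eq_three hU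
  obtain ⟨a', b', c', hab', hac', hbc', rfl, h₁', h₂'⟩ := hT.exists_path_of_card_eq_three hU'
  rw [hasSource_iff_of_path hM h₁ h₂ hac, hasSource_iff_of_path hM h₁' h₂' hac'] at hUU'
  have hca : M.arc c a ↔ M.arc c' a' := by
    have := hT a c hac
    have := hT a' c' hac'
    have := hM.2.1 a c
    have := hM.2.1 a' c'
    tauto
  have hba := hM.2.1 _ _ h₁
  have hcb := hM.2.1 _ _ h₂
  have hba' := hM.2.1 _ _ h₁'
  have hcb' := hM.2.1 _ _ h₂'
  obtain ⟨g, hg, hgi⟩ := h.exists_auto_image_range (f := ![a, b, c]) (f' := ![a', b', c'])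
    (by
      intro i j
      fin_cases i <;> fin_cases j <;> simp [hab, hac, hbc, hab.symm, hac.symm, hbc.symm])
    (by intro i j; fin_cases i <;> fin_cases j <;>
          simp [hab', hac', hbc', hab'.symm, hac'.symm, hbc'.symm])
    (by intro i j; fin_cases i <;> fin_cases j <;> simp [hM.1, *])
    (fun i j => iff_of_false (hT.noEdges hM _ _) (hT.noEdges hM _ _))
  refine ⟨g, hg, ?_⟩
  convert hgi using 2
  · ext; simp; tauto
  · ext; simp; tauto

/-- A finite set-homogeneous tournament has no transitive triangles. -/
theorem IsTournament.not_transitive_triangle [Fintype V] (hT : M.IsTournament) (hM : M.IsS)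
    (h : M.SetHomogeneous) {a b c : V} (hab : M.arc a b) (hbc : M.arc b c) : ¬ M.arc a c := by
  classical
  intro hac
  have hne : a ≠ b := by rintro rfl; exact hM.1 _ hab
  have hne' : b ≠ c := by rintro rfl; exact hM.1 _ hbc
  have hne'' : a ≠ c := by rintro rfl; exact hM.1 _ hac
  have hcyc : ∃ x y z, M.arc x y ∧ M.arc y z ∧ x ≠ z ∧ ¬ M.arc x z := by
    by_contra! hcyc
    have : IsTrans V M.arc := ⟨fun x y z hxy hyz => hcyc x y z hxy hyz (by
      rintro rfl; exact hM.2.1 _ _ hxy hyz)⟩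
    have : Std.Irrefl M.arc := ⟨hM.1⟩
    obtain ⟨m, -, hm⟩ := (Finite.wellFounded_of_trans_of_irrefl M.arc).has_min Set.univ ⟨a, trivial⟩
    obtain ⟨g, hg, hgb⟩ := h.exists_auto_apply hM b m
    exact hm (g a) trivial (hgb ▸ (hg.1 _ _).1 hab)
  obtain ⟨x, y, z, hxy, hyz, hxz, hnxz⟩ := hcyc
  have hxy' : x ≠ y := by rintro rfl; exact hM.1 _ hxy
  have hyz' : y ≠ z := by rintro rfl; exact hM.1 _ hyz
  have h1 : Odd (Finset.powersetCard 1 (Finset.univ : Finset V)).card := by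
    refine hT.odd_card_of_isOrbit hM (U := {a}) ?_ ?_
    · intro g _
      simp
    · intro U' hU'
      obtain ⟨u, rfl⟩ := Finset.card_eq_one.1 (Finset.mem_powersetCard.1 hU').2
      obtain ⟨g, hg, hgu⟩ := h.exists_auto_apply hM a u
      exact ⟨g, hg, by simp [hgu]⟩
  have h2 : Odd (Finset.powersetCard 2 (Finset.univ : Finset V)).card := by
    refine hT.odd_card_of_isOrbit hM (U := {a, b}) ?_ ?_
    · intro g _
      simp [hne]
    · intro U' hU'
      obtain ⟨u, v, huv, rfl⟩ := Finset.card_eq_two.1 (Finset.mem_powersetCard.1 hU').2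
      have : ∃ g : V ≃ V, M.IsAuto g ∧ ((g a = u ∧ g b = v) ∨ (g a = v ∧ g b = u)) := by
        have hE := hT.noEdges hM
        have hba := hM.2.1 _ _ hab
        rcases hT u v huv with h' | h'
        · have hn := hM.2.1 _ _ h'
          exact h.exists_auto_pair hM hne huv (by simp [*]) (by simp [*])
            (iff_of_false (hE _ _) (hE _ _))
        · have hn := hM.2.1 _ _ h'
          obtain ⟨g, hg, hg'⟩ := h.exists_auto_pair hM hne huv.symm (by simp [*]) (by simp [*])
            (iff_of_false (hE _ _) (hE _ _))
          exact ⟨g, hg, hg'.symm⟩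
      obtain ⟨g, hg, hg' | hg'⟩ := this
      · exact ⟨g, hg, by simp [Set.image_pair, hg']⟩
      · exact ⟨g, hg, by simp [Set.image_pair, hg', Set.pair_comm]⟩
  have h3 : Odd ((Finset.powersetCard 3 (Finset.univ : Finset V)).filter M.HasSource).card := by
    refine hT.odd_card_of_isOrbit hM (U := {a, b, c}) ?_ ?_
    · intro g hg
      rw [Finset.mem_filter, hasSource_image_iff hg, hasSource_iff_of_path hM hab hbc hne'']
      simp [hac, hne, hne', hne'']
    · intro U' hU'
      rw [Finset.mem_filter, Finset.mem_powersetCard] at hU'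
      exact hT.exists_auto_of_hasSource_iff hM h (by simp [hne, hne', hne'']) hU'.1.2
        (by simp [hasSource_iff_of_path hM hab hbc hne'', hac, hU'.2])
  have h4 : Odd ((Finset.powersetCard 3 (Finset.univ : Finset V)).filter
      (fun U => ¬ M.HasSource U)).card := by
    refine hT.odd_card_of_isOrbit hM (U := {x, y, z}) ?_ ?_
    · intro g hg
      rw [Finset.mem_filter, hasSource_image_iff hg, hasSource_iff_of_path hM hxy hyz hxz]
      simp [hnxz, hxy', hyz', hxz]
    · intro U' hU'
      rw [Finset.mem_filter, Finset.mem_powersetCard] at hU'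
      exact hT.exists_auto_of_hasSource_iff hM h (by simp [hxy', hyz', hxz]) hU'.1.2
        (by simp [hasSource_iff_of_path hM hxy hyz hxz, hnxz, hU'.2])
  have h5 := Finset.card_filter_add_card_filter_not
    (s := Finset.powersetCard 3 (Finset.univ : Finset V))
    M.HasSource
  have h6 : ∀ n : ℕ, Odd (n.choose 1) → Odd (n.choose 2) → Odd (n.choose 3) := by
    intro n hn1 hn2
    rw [Nat.choose_one_right] at hn1
    have h2n : 2 ≤ n := by
      by_contra! hlt
      rw [Nat.choose_eq_zero_of_lt hlt] at hn2
      simp at hn2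
    have := Nat.choose_succ_right_eq n 2
    have hodd : Odd (n.choose 3 * 3) := by
      rw [this]
      exact hn2.mul (Nat.Odd.sub_even h2n hn1 even_two)
    exact (Nat.odd_mul.1 hodd).1
  simp only [Finset.card_powersetCard] at h1 h2 h5
  have h7 := h6 _ h1 h2
  rw [← h5] at h7
  exact Nat.not_even_iff_odd.2 h7 (h3.add_odd h4)

end Tournaments

end SDigraph

namespace SDigraph

section Rotations

variable {V : Type*} {M : SDigraph V} {r : ZMod 3 → V → V}

/-- `r` is an action of `ℤ/3` whose orbits are the Γ-components of `M`, each of them a copy of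
`D₃`. -/
structure IsRotation (M : SDigraph V) (r : ZMod 3 → V → V) : Prop where
  zero (x : V) : r 0 x = x
  add (i j : ZMod 3) (x : V) : r i (r j x) = r (i + j) x
  arc_iff (x y : V) : M.arc x y ↔ y = r 1 x
  not_edge (x : V) (i : ZMod 3) : ¬ M.edge x (r i x)

/-- `x` and `y` lie in different orbits of `r`. -/
def Cross (r : ZMod 3 → V → V) (x y : V) : Prop := ∀ i, y ≠ r i x

/-- The edges between the orbits of `x` and `y` form a perfect matching commuting with `r`. -/
def Matched (M : SDigraph V) (r : ZMod 3 → V → V) (x y : V) : Prop :=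
  ∃ t, ∀ i j, M.edge (r i x) (r j y) ↔ j = i + t

/-- The complement of `SDigraph.Matched`. -/
def CoMatched (M : SDigraph V) (r : ZMod 3 → V → V) (x y : V) : Prop :=
  ∃ t, ∀ i j, M.edge (r i x) (r j y) ↔ j ≠ i + t

namespace IsRotation

theorem free (hr : M.IsRotation r) (hM : M.IsS) {x : V} {i : ZMod 3} : r i x = x ↔ i = 0 := by
  have h₁ : r 1 x ≠ x := fun h => hM.1 x ((hr.arc_iff x x).2 h.symm)
  have h₂ : r 2 x ≠ x := fun h => by
    have := congrArg (r 1) h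
    rw [hr.add, show (1 + 2 : ZMod 3) = 0 from rfl, hr.zero] at this
    exact h₁ this.symm
  fin_cases i
  · exact iff_of_true (hr.zero x) rfl
  · exact iff_of_false h₁ one_ne_zero
  · exact iff_of_false h₂ (show (2 : ZMod 3) ≠ 0 by decide)

theorem rot_inj (hr : M.IsRotation r) (hM : M.IsS) {x : V} {i j : ZMod 3} :
    r i x = r j x ↔ i = j := by
  refine ⟨fun h => ?_, fun h => h ▸ rfl⟩
  have := congrArg (r (-j)) h
  rw [hr.add, hr.add, neg_add_cancel, hr.zero, hr.free hM] at this
  exact (neg_add_eq_zero.1 this).symm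

theorem eq_rot_iff (hr : M.IsRotation r) {x y : V} {i : ZMod 3} : y = r i x ↔ r (-i) y = x := by
  constructor
  · rintro rfl
    rw [hr.add, neg_add_cancel, hr.zero]
  · rintro rfl
    rw [hr.add, add_neg_cancel, hr.zero]

theorem cross_rot (hr : M.IsRotation r) {x y : V} (h : Cross r x y) (i j : ZMod 3) :
    Cross r (r i x) (r j y) := by
  intro k hk
  refine h (-j + (k + i)) ?_
  rw [hr.add] at hk
  rw [← hr.add, ← hk, hr.add, neg_add_cancel, hr.zero]

theorem cross_symm (hr : M.IsRotation r) {x y : V} (h : Cross r x y) : Cross r y x :=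
  fun i hi => h (-i) (hr.eq_rot_iff.1 hi).symm

theorem cross_of_edge (hr : M.IsRotation r) {x y : V} (h : M.edge x y) : Cross r x y :=
  fun i hi => hr.not_edge x i (hi ▸ h)

theorem not_cross_rot (hr : M.IsRotation r) (x : V) (i j : ZMod 3) :
    ¬ Cross r (r i x) (r j x) := fun h => h (j - i) (by rw [hr.add, sub_add_cancel])

theorem map_rot (hr : M.IsRotation r) {g : V ≃ V} (hg : M.IsAuto g) (i : ZMod 3) (x : V) :
    g (r i x) = r i (g x) := by
  have h₁ : ∀ x, g (r 1 x) = r 1 (g x) := fun x =>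
    (hr.arc_iff _ _).1 ((hg.1 _ _).1 ((hr.arc_iff _ _).2 rfl))
  fin_cases i
  · exact (congrArg g (hr.zero x)).trans (hr.zero _).symm
  · exact h₁ x
  · change g (r 2 x) = r 2 (g x)
    rw [show (2 : ZMod 3) = 1 + 1 from rfl, ← hr.add, ← hr.add, h₁, h₁]

theorem cross_map (hr : M.IsRotation r) {g : V ≃ V} (hg : M.IsAuto g) {x y : V} :
    Cross r (g x) (g y) ↔ Cross r x y := by
  simp only [Cross, ← hr.map_rot hg, g.injective.ne_iff]

theorem not_arc_of_cross (hr : M.IsRotation r) {x y : V} (h : Cross r x y) : ¬ M.arc x y :=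
  fun hxy => h 1 ((hr.arc_iff x y).1 hxy)

theorem ne_of_cross (hr : M.IsRotation r) {x y : V} (h : Cross r x y) : x ≠ y := by
  rintro rfl
  exact h 0 (hr.zero x).symm

theorem compl (hr : M.IsRotation r) : M.compl.IsRotation fun i => r (-i) where
  zero x := by simpa using hr.zero x
  add i j x := by rw [hr.add, neg_add]
  arc_iff x y := by
    change M.arc y x ↔ _
    rw [hr.arc_iff, hr.eq_rot_iff]
    exact eq_comm
  not_edge x i := by
    have h₂ : r (-2) x = r 1 x := rfl
    have h₁ : r (-1) x = r 2 x := rfl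
    have h₃ : x = r 1 (r 2 x) := by rw [hr.add]; exact (hr.zero x).symm
    rintro ⟨hne, hn, hxy, hyx⟩
    rw [hr.arc_iff] at hxy hyx
    fin_cases i
    · exact hne (hr.zero x).symm
    · exact hyx h₃
    · exact hxy h₂

theorem cross_neg (r : ZMod 3 → V → V) {x y : V} :
    Cross (fun i => r (-i)) x y ↔ Cross r x y :=
  ⟨fun h i => by simpa using h (-i), fun h i => h (-i)⟩

/-- Two pairs of vertices in different components with the same adjacency have, up to
transposition, the same pattern of edges between their components. -/
theorem edge_pattern (hr : M.IsRotation r) (hM : M.IsS) (h : M.SetHomogeneous) {x y x' y' : V}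
    (hxy : Cross r x y) (hxy' : Cross r x' y') (he : M.edge x y ↔ M.edge x' y') :
    (∀ i j, M.edge (r i x) (r j y) ↔ M.edge (r i x') (r j y')) ∨
      ∀ i j, M.edge (r i x) (r j y) ↔ M.edge (r j x') (r i y') := by
  obtain ⟨g, hg, ⟨h₁, h₂⟩ | ⟨h₁, h₂⟩⟩ := h.exists_auto_pair hM (hr.ne_of_cross hxy)
    (hr.ne_of_cross hxy')
    (iff_of_false (hr.not_arc_of_cross hxy) (hr.not_arc_of_cross hxy'))
    (iff_of_false (hr.not_arc_of_cross (hr.cross_symm hxy))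
      (hr.not_arc_of_cross (hr.cross_symm hxy'))) he
  · left
    intro i j
    rw [hg.2, hr.map_rot hg, hr.map_rot hg, h₁, h₂]
  · right
    intro i j
    rw [hg.2, hr.map_rot hg, hr.map_rot hg, h₁, h₂]
    exact ⟨hM.2.2.2.1 _ _, hM.2.2.2.1 _ _⟩

end IsRotation


theorem natPattern_classification : ∀ n : Fin 512,
    let P : ZMod 3 → ZMod 3 → Bool := fun i j => n.val.testBit (3 * i.val + j.val)
    (∀ a b c d, P a b = P c d → (∀ i j, P (i + a) (j + b) = P (i + c) (j + d)) ∨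
      ∀ i j, P (i + a) (j + b) = P (j + c) (i + d)) →
    (∀ i j, P i j = P 0 0) ∨ (∃ t, ∀ i j, P i j = decide (j = i + t)) ∨
      ∃ t, ∀ i j, P i j = !decide (j = i + t) := by
  decide +kernel

/-- A pattern on `ℤ/3 × ℤ/3` in which any two equal entries are related by translations, possibly
combined with the transposition, is constant, a translated diagonal, or the complement of one. -/
theorem pattern_classification (P : ZMod 3 → ZMod 3 → Prop)
    (hP : ∀ a b c d, (P a b ↔ P c d) → (∀ i j, P (i + a) (j + b) ↔ P (i + c) (j + d)) ∨
      ∀ i j, P (i + a) (j + b) ↔ P (j + c) (i + d)) :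
    (∀ i j, P i j ↔ P 0 0) ∨ (∃ t, ∀ i j, P i j ↔ j = i + t) ∨
      ∃ t, ∀ i j, P i j ↔ j ≠ i + t := by
  classical
  let f : Fin 9 → Bool := fun k => decide (P ((k.val / 3 : ℕ) : ZMod 3) ((k.val % 3 : ℕ) : ZMod 3))
  have hf : ∀ i j : ZMod 3, (Nat.ofBits f).testBit (3 * i.val + j.val) = decide (P i j) := by
    intro i j
    have hi := ZMod.val_lt i
    have hj := ZMod.val_lt j
    rw [Nat.testBit_ofBits_lt f _ (by omega)]
    simp only [f]
    rw [show (3 * i.val + j.val) / 3 = i.val by omega,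
      show (3 * i.val + j.val) % 3 = j.val by omega,
      ZMod.natCast_zmod_val, ZMod.natCast_zmod_val]
  have := natPattern_classification ⟨Nat.ofBits f, Nat.ofBits_lt_two_pow f⟩
  simp only [hf, ← decide_not, decide_eq_decide] at this
  exact this hP

namespace IsRotation

theorem constant_or_matched (hr : M.IsRotation r) (hM : M.IsS) (h : M.SetHomogeneous) {x y : V}
    (hxy : Cross r x y) :
    (∀ i j, M.edge (r i x) (r j y) ↔ M.edge x y) ∨ M.Matched r x y ∨ M.CoMatched r x y := by
  have := pattern_classification (fun i j => M.edge (r i x) (r j y)) (fun a b c d habcd => by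
    simpa only [hr.add] using
      hr.edge_pattern hM h (hr.cross_rot hxy a b) (hr.cross_rot hxy c d) habcd)
  simp only [hr.zero] at this
  exact this

theorem matched_rot (hr : M.IsRotation r) {x y : V} (a b : ZMod 3) :
    M.Matched r (r a x) (r b y) ↔ M.Matched r x y := by
  have key : ∀ (a b : ZMod 3) {x y : V}, M.Matched r x y → M.Matched r (r a x) (r b y) := by
    rintro a b x y ⟨t, ht⟩
    refine ⟨a + t - b, fun i j => ?_⟩
    rw [hr.add, hr.add, ht]
    constructor <;> intro h <;> linear_combination h
  refine ⟨fun h => ?_, key a b⟩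
  simpa only [hr.add, neg_add_cancel, hr.zero] using key (-a) (-b) h

theorem matched_of_matched (hr : M.IsRotation r) (hM : M.IsS) (h : M.SetHomogeneous)
    {x y x' y' : V} (hxy : Cross r x y) (hxy' : Cross r x' y') (hm : M.Matched r x y) :
    M.Matched r x' y' := by
  have key : ∃ a, M.edge x (r a y) ↔ M.edge x' y' := by
    obtain ⟨t, ht⟩ := hm
    have ht' : ∀ j, M.edge x (r j y) ↔ j = t := fun j => by simpa [hr.zero] using ht 0 j
    by_cases he : M.edge x' y'
    · exact ⟨t, by simp [ht', he]⟩
    · exact ⟨t + 1, by simp [ht', he]⟩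
  obtain ⟨a, ha⟩ := key
  have hc : Cross r x (r a y) := by simpa [hr.zero] using hr.cross_rot hxy 0 a
  have hm' : M.Matched r x (r a y) := by simpa [hr.zero] using (hr.matched_rot 0 a).2 hm
  obtain ⟨t, ht⟩ := hm'
  rcases hr.edge_pattern hM h hc hxy' ha with hp | hp
  · exact ⟨t, fun i j => by rw [← hp, ht]⟩
  · exact ⟨-t, fun i j => by rw [← hp, ht, eq_add_neg_iff_add_eq]; exact eq_comm⟩

theorem matched_compl (hr : M.IsRotation r) {x y : V} (hxy : Cross r x y)
    (hm : M.CoMatched r x y) : M.compl.Matched (fun i => r (-i)) x y := by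
  obtain ⟨t, ht⟩ := hm
  refine ⟨-t, fun i j => ?_⟩
  have hc := hr.cross_rot hxy (-i) (-j)
  have h₁ := hr.ne_of_cross hc
  have h₂ := hr.not_arc_of_cross hc
  have h₃ := hr.not_arc_of_cross (hr.cross_symm hc)
  simp only [SDigraph.compl, ht, h₁, h₂, h₃, ne_eq, not_not, not_false_eq_true, true_and, and_true]
  constructor <;> intro h <;> linear_combination -h

end IsRotation

section MatchedComponents

/-- In a matching, the adjacency of a pair determines the pattern. -/
theorem Matched.edge_rot_iff (hr : M.IsRotation r) {x y : V} (hm : M.Matched r x y)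
    (he : M.edge x y) (i j : ZMod 3) : M.edge (r i x) (r j y) ↔ i = j := by
  obtain ⟨t, ht⟩ := hm
  have h0 := (ht 0 0).1 (by simpa [hr.zero] using he)
  rw [ht, show t = 0 by simpa using h0.symm, add_zero]
  exact eq_comm

theorem edge_rot_iff (hr : M.IsRotation r) (hm : ∀ x y, Cross r x y → M.Matched r x y)
    {x y : V} (he : M.edge x y) (i j : ZMod 3) :
    M.edge (r i x) (r j y) ↔ i = j :=
  (hm x y (hr.cross_of_edge he)).edge_rot_iff hr he i j

theorem no_edge_triangle (hr : M.IsRotation r) (hM : M.IsS) (h : M.SetHomogeneous)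
    (hm : ∀ x y, Cross r x y → M.Matched r x y)
    {b c d : V} (hbc : M.edge b c) (hbd : M.edge b d) : ¬ M.edge c d := by
  intro hcd
  have hs := hM.2.2.2.1
  have hE : ∀ {x y} (_ : M.edge x y) (j : ZMod 3), M.edge x (r j y) ↔ j = 0 := by
    intro x y he j
    simpa [hr.zero, eq_comm] using edge_rot_iff hr hm he 0 j
  have hE' : ∀ {x y} (_ : M.edge x y) (j : ZMod 3), M.edge (r j y) x ↔ j = 0 :=
    fun he j => ⟨fun h' => (hE he j).1 (hs _ _ h'), fun h' => hs _ _ ((hE he j).2 h')⟩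
  have hcr : ∀ {x y} (_ : M.edge x y) (j : ZMod 3), Cross r x (r j y) := fun he j => by
    simpa [hr.zero] using hr.cross_rot (hr.cross_of_edge he) 0 j
  have hA : ∀ {x y} (_ : M.edge x y) (j : ZMod 3), ¬ M.arc x (r j y) :=
    fun he j => hr.not_arc_of_cross (hcr he j)
  have hA' : ∀ {x y} (_ : M.edge x y) (j : ZMod 3), ¬ M.arc (r j y) x :=
    fun he j => hr.not_arc_of_cross (hr.cross_symm (hcr he j))
  have hne : ∀ {x y} (_ : M.edge x y) (j : ZMod 3), x ≠ r j y :=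
    fun he j => hr.ne_of_cross (hcr he j)
  have hbc' : b ≠ c := hr.ne_of_cross (hr.cross_of_edge hbc)
  have h1 : (1 : ZMod 3) ≠ 0 := by decide
  have h2 : (2 : ZMod 3) ≠ 0 := by decide
  have hinj : ∀ j : ZMod 3, Function.Injective ![b, c, r j d] := by
    intro j i k
    fin_cases i <;> fin_cases k <;>
      simp [hbc', hbc'.symm, hne hbd j, hne hcd j, (hne hbd j).symm, (hne hcd j).symm]
  obtain ⟨g, hg, hgi⟩ := h.exists_auto_image_range (hinj 1) (hinj 2)
    (by
      intro i k
      fin_cases i <;> fin_cases k <;>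
        simp [hM.1, hA hbd, hA hcd, hA' hbd, hA' hcd])
    (by
      intro i k
      fin_cases i <;> fin_cases k <;>
        simp [hM.2.2.1, hE hbd, hE hcd, hE' hbd, hE' hcd, h1, h2])
  have hmem : ∀ i, g (![b, c, r 1 d] i) ∈ Set.range ![b, c, r 2 d] :=
    fun i => hgi ▸ ⟨_, ⟨i, rfl⟩, rfl⟩
  have hb := hmem 0
  have hc := hmem 1
  have hd := hmem 2
  have hgbc := (hg.2 _ _).1 hbc
  have hgd : ∀ x, M.edge x d → ¬ M.edge (g x) (g (r 1 d)) := fun x hx h' =>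
    h1 ((hE hx 1).1 ((hg.2 _ _).2 h'))
  have hgb := hgd b hbd
  have hgc := hgd c hcd
  have hbc'' := hs _ _ hbc
  have hgbc_ne : g b ≠ g c := g.injective.ne hbc'
  have hgbd_ne : g b ≠ g (r 1 d) := g.injective.ne (hne hbd 1)
  have hgcd_ne : g c ≠ g (r 1 d) := g.injective.ne (hne hcd 1)
  have hgd_eq : g (r 1 d) = r 2 d := by
    simp only [Set.mem_range, Fin.exists_fin_succ, Matrix.cons_val_zero, Matrix.cons_val_succ,
      Matrix.cons_val_one, Matrix.cons_val, IsEmpty.exists_iff, or_false] at hb hc hd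
    grind
  have hgd' : g d = r 1 d := by
    rw [hr.map_rot hg] at hgd_eq
    have := congrArg (r (-1)) hgd_eq
    rw [hr.add, hr.add, neg_add_cancel, hr.zero] at this
    exact this
  have hgb_edge : M.edge (g b) (r 1 d) := hgd' ▸ (hg.2 _ _).1 hbd
  have hb' : g b = b ∨ g b = c ∨ g b = r 2 d := by
    obtain ⟨i, hi⟩ := hb
    fin_cases i
    · exact Or.inl hi.symm
    · exact Or.inr (Or.inl hi.symm)
    · exact Or.inr (Or.inr hi.symm)
  rcases hb' with h' | h' | h'
  · exact h1 ((hE hbd 1).1 (h' ▸ hgb_edge))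
  · exact h1 ((hE hcd 1).1 (h' ▸ hgb_edge))
  · exact hgbd_ne (h'.trans hgd_eq.symm)

/-- The stabilizer of a vertex is transitive on its neighbours. -/
theorem exists_auto_fix_of_edge (hr : M.IsRotation r) (hM : M.IsS) (h : M.SetHomogeneous)
    (hm : ∀ x y, Cross r x y → M.Matched r x y)
    {b y y' : V} (hby : M.edge b y) (hby' : M.edge b y') :
    ∃ g : V ≃ V, M.IsAuto g ∧ g b = b ∧ g y = y' := by
  have hs := hM.2.2.2.1
  have hE : ∀ {y} (_ : M.edge b y) (j : ZMod 3), M.edge (r j b) y ↔ j = 0 := by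
    intro y he j
    simpa [hr.zero] using edge_rot_iff hr hm he j 0
  have hE' : ∀ {y} (_ : M.edge b y) (j : ZMod 3), M.edge y (r j b) ↔ j = 0 :=
    fun he j => ⟨fun h' => (hE he j).1 (hs _ _ h'), fun h' => hs _ _ ((hE he j).2 h')⟩
  have hcr : ∀ {y} (_ : M.edge b y) (j : ZMod 3), Cross r (r j b) y := fun he j => by
    simpa [hr.zero] using hr.cross_rot (hr.cross_of_edge he) j 0
  have hA : ∀ {y} (_ : M.edge b y) (j : ZMod 3), ¬ M.arc (r j b) y :=
    fun he j => hr.not_arc_of_cross (hcr he j)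
  have hA' : ∀ {y} (_ : M.edge b y) (j : ZMod 3), ¬ M.arc y (r j b) :=
    fun he j => hr.not_arc_of_cross (hr.cross_symm (hcr he j))
  have hne : ∀ {y} (_ : M.edge b y) (j : ZMod 3), r j b ≠ y :=
    fun he j => hr.ne_of_cross (hcr he j)
  have hI : ∀ i j : ZMod 3, ¬ M.edge (r i b) (r j b) := fun i j he =>
    hr.not_cross_rot b i j (hr.cross_of_edge he)
  have hinj : ∀ {y} (_ : M.edge b y), Function.Injective ![r 0 b, r 1 b, r 2 b, y] := by
    intro y he i k
    have h01 : (0 : ZMod 3) ≠ 1 := by decide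
    have h02 : (0 : ZMod 3) ≠ 2 := by decide
    have h12 : (1 : ZMod 3) ≠ 2 := by decide
    fin_cases i <;> fin_cases k <;>
      simp [hr.rot_inj hM, hne he, (hne he _).symm, h01, h02, h12, h01.symm, h02.symm, h12.symm]
  obtain ⟨g, hg, hgi⟩ := h.exists_auto_image_range (hinj hby) (hinj hby')
    (by
      intro i k
      fin_cases i <;> fin_cases k <;>
        simp [hM.1, hA hby, hA hby', hA' hby, hA' hby'])
    (by
      intro i k
      fin_cases i <;> fin_cases k <;>
        simp [hM.2.2.1, hE hby, hE hby', hE' hby, hE' hby', hI])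
  have hmem : ∀ i, (∃ j, g (![r 0 b, r 1 b, r 2 b, y] i) = r j b) ∨
      g (![r 0 b, r 1 b, r 2 b, y] i) = y' := by
    intro i
    have : g (![r 0 b, r 1 b, r 2 b, y] i) ∈ Set.range ![r 0 b, r 1 b, r 2 b, y'] :=
      hgi ▸ ⟨_, ⟨i, rfl⟩, rfl⟩
    obtain ⟨k, hk⟩ := this
    rw [← hk]
    fin_cases k
    · exact Or.inl ⟨0, rfl⟩
    · exact Or.inl ⟨1, rfl⟩
    · exact Or.inl ⟨2, rfl⟩
    · exact Or.inr rfl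
  have hcross : ∀ j, Cross r (g (r j b)) (g y) := fun j => (hr.cross_map hg).2 (hcr hby j)
  have hy : g y = y' := by
    rcases hmem 3 with ⟨k, hk⟩ | hk
    · change g y = r k b at hk
      have key : ∀ i : Fin 4, ∀ j, ![r 0 b, r 1 b, r 2 b, y] i = r j b → g (r j b) = y' := by
        intro i j hij
        rcases hmem i with ⟨l, hl⟩ | hl
        · have := hcross j
          rw [← hij, hl, hk] at this
          exact (hr.not_cross_rot b l k this).elim
        · rw [← hij, hl]
      have := g.injective ((key 0 0 rfl).trans (key 1 1 rfl).symm)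
      rw [hr.rot_inj hM] at this
      exact absurd this (by decide)
    · exact hk
  refine ⟨g, hg, ?_, hy⟩
  rcases hmem 0 with ⟨k, hk⟩ | hk
  · change g (r 0 b) = r k b at hk
    rw [hr.zero] at hk
    have := (hg.2 _ _).1 hby
    rw [hk, hy, hE hby'] at this
    rw [hk, this, hr.zero]
  · have := hcross 0
    rw [show g (r 0 b) = y' from hk, hy] at this
    exact (hr.ne_of_cross this rfl).elim

/-- There are at most two components. -/
theorem not_three_cross [Finite V] (hr : M.IsRotation r) (hM : M.IsS) (h : M.SetHomogeneous)
    (hm : ∀ x y, Cross r x y → M.Matched r x y)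
    {x y z : V} (hxy : Cross r x y) (hxz : Cross r x z) :
    ¬ Cross r y z := by
  intro hyz
  have hs := hM.2.2.2.1
  have htri := @no_edge_triangle _ _ _ hr hM h hm
  have hrot : ∀ {u v} (i j : ZMod 3), M.edge u v → i = j → M.edge (r i u) (r j v) :=
    fun i j he hij => (edge_rot_iff hr hm he i j).2 hij
  let N := {y : V // M.edge x y}
  let lt : N → N → Prop := fun y z => M.edge (r 1 y.1) z.1
  have hirr : ∀ y : N, ¬ lt y y := fun y hy =>
    hr.not_cross_rot y.1 1 0 (by simpa [hr.zero] using hr.cross_of_edge hy)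
  have htrans : ∀ y z w : N, lt y z → lt z w → lt y w := by
    intro y z w hyz hzw
    have h₁ : M.edge (r 2 y.1) (r 1 z.1) := by
      simpa [hr.add, show (1 + 1 : ZMod 3) = 2 from rfl] using hrot 1 1 hyz rfl
    have hcyw : Cross r y.1 w.1 := by
      intro k hk
      have hk0 : k = 0 := by
        have := w.2
        rw [hk] at this
        simpa [hr.zero, eq_comm] using (edge_rot_iff hr hm y.2 0 k).1
          (by simpa [hr.zero] using this)
      rw [hk0, hr.zero] at hk
      have h₂ := hs _ _ hzw
      rw [hk] at h₂
      have h₃ := (edge_rot_iff hr hm h₂ 2 0).1 (by simpa [hr.zero] using h₁)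
      exact absurd h₃ (by decide)
    obtain ⟨t, ht⟩ := hm _ _ hcyw
    have hnot : ¬ M.edge y.1 w.1 := htri y.2 w.2
    have hnot' : ¬ M.edge (r 2 y.1) w.1 := fun h' => htri h₁ h' hzw
    have h₀ := ht 0 0
    have h₁' := ht 1 0
    have h₂' := ht 2 0
    simp only [hr.zero] at h₀ h₁' h₂'
    rw [h₀] at hnot
    rw [h₂'] at hnot'
    change M.edge (r 1 y.1) w.1
    rw [h₁']
    revert hnot hnot'
    clear * - 
    revert t
    decide
  have hnbr : ∀ u, Cross r x u → ∃ i, M.edge x (r i u) := by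
    intro u hu
    obtain ⟨t, ht⟩ := hm _ _ hu
    exact ⟨t, by simpa [hr.zero] using (ht 0 t).2 (zero_add t).symm⟩
  obtain ⟨i, hi⟩ := hnbr y hxy
  obtain ⟨j, hj⟩ := hnbr z hxz
  have hex : ∃ a b : N, lt a b := by
    have hc := hr.cross_rot hyz i j
    obtain ⟨t, ht⟩ := hm _ _ hc
    have hnot : ¬ M.edge (r i y) (r j z) := htri hi hj
    have h₀ := ht 0 0
    have h₁ := ht 1 0
    have h₂ := ht 0 1
    rw [hr.zero, hr.zero] at h₀
    rw [hr.zero] at h₁ h₂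
    rw [h₀] at hnot
    have : t = 1 ∨ t = 2 := by
      clear * - hnot
      revert t
      decide
    rcases this with rfl | rfl
    · exact ⟨⟨_, hj⟩, ⟨_, hi⟩, hs _ _ (h₂.2 (by decide))⟩
    · exact ⟨⟨_, hi⟩, ⟨_, hj⟩, h₁.2 (by decide)⟩
  obtain ⟨a, b, hab⟩ := hex
  have : IsTrans N lt := ⟨htrans⟩
  have : Std.Irrefl lt := ⟨hirr⟩
  obtain ⟨m, -, hmin⟩ := (Finite.wellFounded_of_trans_of_irrefl lt).has_min Set.univ ⟨a, trivial⟩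
  obtain ⟨g, hg, hgx, hgb⟩ := exists_auto_fix_of_edge hr hM h hm b.2 m.2
  refine hmin ⟨g a.1, by simpa [hgx] using (hg.2 _ _).1 a.2⟩ trivial ?_
  change M.edge (r 1 (g a.1)) m.1
  rw [← hr.map_rot hg, ← hgb, ← hg.2]
  exact hab

end MatchedComponents

end Rotations

end SDigraph

namespace SDigraph

section Structure

variable {V : Type*} {M : SDigraph V} {r : ZMod 3 → V → V}

/-- If the Γ-components of a finite set-homogeneous s-digraph with arcs are tournaments, then they
are directed triangles. -/
theorem exists_isRotation [Finite V] (hM : M.IsS) (h : M.SetHomogeneous)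
    (hcomp : ∀ u v, M.Reach u v → u ≠ v → M.arc u v ∨ M.arc v u) (harc : ∃ u v, M.arc u v) :
    ∃ r : ZMod 3 → V → V, M.IsRotation r ∧ ∀ i x, M.Reach x (r i x) := by
  classical
  have := Fintype.ofFinite V
  have hne : ∀ {u v}, M.arc u v → u ≠ v := by
    rintro u _ huv rfl
    exact hM.1 _ huv
  have htri : ∀ a b c, M.arc a b → M.arc b c → ¬ M.arc a c := by
    intro a b c hab hbc hac
    have hT : (M.induce {v | M.Reach a v}).IsTournament := fun u v huv =>
      hcomp u v (u.2.symm.trans v.2) (fun h => huv (Subtype.ext h))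
    exact hT.not_transitive_triangle (hM.induce _) (h.induce_reach a)
      (a := ⟨a, Reach.refl M a⟩) (b := ⟨b, reach_of_arc hab⟩) (c := ⟨c, reach_of_arc hac⟩)
      hab hbc hac
  have hout : ∀ x, ∃ y, M.arc x y := by
    obtain ⟨u, v, huv⟩ := harc
    intro x
    obtain ⟨g, hg, rfl⟩ := h.exists_auto_apply hM u x
    exact ⟨g v, (hg.1 _ _).1 huv⟩
  choose s hs using hout
  have huniq : ∀ {x y}, M.arc x y ↔ y = s x := by
    intro x y
    refine ⟨fun hxy => ?_, fun hxy => hxy ▸ hs x⟩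
    by_contra hy
    rcases hcomp y (s x) ((reach_of_arc hxy).symm.trans (reach_of_arc (hs x))) hy with h' | h'
    · exact htri _ _ _ hxy h' (hs x)
    · exact htri _ _ _ (hs x) h' hxy
  have hs3 : ∀ x, s (s (s x)) = x := by
    intro x
    have hn : x ≠ s (s x) := fun hx => hM.2.1 _ _ (hs x) (huniq.2 hx)
    rcases hcomp x (s (s x)) ((reach_of_arc (hs x)).trans (reach_of_arc (hs _))) hn with h' | h'
    · exact (htri _ _ _ (hs x) (hs _) h').elim
    · exact (huniq.1 h').symm
  have hreach : ∀ (i : ZMod 3) x, M.Reach x (s^[i.val] x) := by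
    intro i x
    fin_cases i
    · exact Reach.refl M x
    · exact reach_of_arc (hs x)
    · exact (reach_of_arc (hs x)).trans (reach_of_arc (hs _))
  refine ⟨fun i => s^[i.val], ⟨fun x => rfl, ?_, fun x y => huniq, ?_⟩, hreach⟩
  · intro i j x
    fin_cases i <;> fin_cases j <;>
      first
        | rfl
        | exact hs3 _
  · intro x i he
    have hx : x ≠ s^[i.val] x := fun hx => hM.2.2.1 x (by rw [← hx] at he; exact he)
    rcases hcomp _ _ (hreach i x) hx with h' | h'
    · exact hM.2.2.2.2 _ _ he h'
    · exact hM.2.2.2.2 _ _ (hM.2.2.2.1 _ _ he) h'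

/-- Coordinates given by a transversal of the orbits of a rotation. -/
theorem IsRotation.exists_coordinates (hr : M.IsRotation r) (hM : M.IsS) {Q : Type*} (b : Q → V)
    (hb : ∀ v, ∃ q i, v = r i (b q)) (hb' : ∀ q q', q ≠ q' → Cross r (b q) (b q')) :
    ∃ e : Q × ZMod 3 ≃ V, (∀ p, e p = r p.2 (b p.1)) ∧
      ∀ p q, M.arc (e p) (e q) ↔ p.1 = q.1 ∧ q.2 = p.2 + 1 := by
  have hinj : ∀ {q q' i j}, r i (b q) = r j (b q') → q = q' := by
    intro q q' i j hij
    by_contra hq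
    exact hr.ne_of_cross (hr.cross_rot (hb' q q' hq) i j) hij
  refine ⟨Equiv.ofBijective (fun p => r p.2 (b p.1)) ⟨?_, ?_⟩, fun p => rfl, ?_⟩
  · rintro ⟨q, i⟩ ⟨q', j⟩ hij
    obtain rfl := hinj hij
    exact Prod.ext rfl ((hr.rot_inj hM).1 hij)
  · intro v
    obtain ⟨q, i, rfl⟩ := hb v
    exact ⟨(q, i), rfl⟩
  · rintro ⟨q, i⟩ ⟨q', j⟩
    change M.arc (r i (b q)) (r j (b q')) ↔ q = q' ∧ j = i + 1
    rw [hr.arc_iff, hr.add]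
    constructor
    · intro hij
      obtain rfl := hinj hij
      exact ⟨rfl, ((hr.rot_inj hM).1 hij).trans (add_comm _ _)⟩
    · rintro ⟨rfl, rfl⟩
      rw [add_comm]

/-- If components are joined by perfect matchings, then `M` is `F₆`. -/
theorem IsRotation.iso_F6 [Finite V] (hr : M.IsRotation r) (hM : M.IsS) (h : M.SetHomogeneous)
    {x y : V} (hxy : Cross r x y) (hm : M.Matched r x y) : M.Iso F6 := by
  have hm' : ∀ u v, Cross r u v → M.Matched r u v := fun u v huv =>
    hr.matched_of_matched hM h hxy huv hm
  obtain ⟨z, hz⟩ : ∃ z, M.edge x z := by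
    obtain ⟨t, ht⟩ := hm
    exact ⟨r t y, by simpa [hr.zero] using (ht 0 t).2 (zero_add t).symm⟩
  have hxz := hr.cross_of_edge hz
  have hzx := hr.cross_symm hxz
  have hz' := hM.2.2.2.1 _ _ hz
  obtain ⟨e, he, harc⟩ := hr.exists_coordinates hM ![x, z]
    (by
      intro v
      by_contra! hv
      exact not_three_cross hr hM h hm' hxz (fun i => hv 0 i) (fun i => hv 1 i))
    (by
      intro q q' hq
      fin_cases q <;> fin_cases q' <;> first | exact absurd rfl hq | exact hxz | exact hzx)
  refine ⟨e.symm, fun u v => ?_, fun u v => ?_⟩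
  · obtain ⟨p, rfl⟩ := e.surjective u
    obtain ⟨q, rfl⟩ := e.surjective v
    simpa [F6] using harc p q
  · obtain ⟨⟨p, i⟩, rfl⟩ := e.surjective u
    obtain ⟨⟨q, j⟩, rfl⟩ := e.surjective v
    have h₁ : ∀ w, ¬ M.edge (r i w) (r j w) := fun w hw =>
      hr.not_cross_rot w i j (hr.cross_of_edge hw)
    have h₂ := edge_rot_iff hr hm' hz i j
    have h₃ := edge_rot_iff hr hm' hz' i j
    rw [e.symm_apply_apply, e.symm_apply_apply, he, he]
    simp only [F6]
    fin_cases p <;> fin_cases q <;> simp [h₁, h₂, h₃]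

/-- The partition into orbits of a rotation. -/
def IsRotation.orbitSetoid (hr : M.IsRotation r) : Setoid V where
  r x y := ∃ i, y = r i x
  iseqv :=
    { refl := fun x => ⟨0, (hr.zero x).symm⟩
      symm := fun ⟨i, hi⟩ => ⟨-i, (hr.eq_rot_iff.1 hi).symm⟩
      trans := by
        rintro x y z ⟨i, rfl⟩ ⟨j, rfl⟩
        exact ⟨j + i, hr.add _ _ _⟩ }

/-- The quotient graph on the orbits of a rotation. -/
noncomputable def IsRotation.quotientGraph (hr : M.IsRotation r) :
    SDigraph (Quotient hr.orbitSetoid) :=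
  ⟨fun _ _ => False, fun p q => M.edge p.out q.out⟩

section Quotient

variable (hr : M.IsRotation r)

theorem IsRotation.isS_quotientGraph (hM : M.IsS) : hr.quotientGraph.IsS :=
  ⟨fun _ => id, fun _ _ h => h.elim, fun _ => hM.2.2.1 _, fun _ _ => hM.2.2.2.1 _ _,
    fun _ _ _ => id⟩

theorem IsRotation.cross_out {p q : Quotient hr.orbitSetoid} (hpq : p ≠ q) :
    Cross r p.out q.out := by
  intro i hi
  refine hpq ?_
  rw [← p.out_eq, ← q.out_eq]
  exact Quotient.sound ⟨i, hi⟩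

theorem IsRotation.edge_out_mk_iff
    (hconst : ∀ x y i j, M.edge (r i x) (r j y) ↔ M.edge x y)
    (x y : V) :
    M.edge (Quotient.mk hr.orbitSetoid x).out (Quotient.mk hr.orbitSetoid y).out ↔ M.edge x y := by
  obtain ⟨i, hi⟩ := Quotient.exact (Quotient.mk hr.orbitSetoid x).out_eq
  obtain ⟨j, hj⟩ := Quotient.exact (Quotient.mk hr.orbitSetoid y).out_eq
  rw [hi, hj, hconst, ← hi, ← hj]

theorem IsRotation.setHomogeneous_quotientGraph
    (hconst : ∀ x y i j, M.edge (r i x) (r j y) ↔ M.edge x y)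
    (hM : M.IsS) (h : M.SetHomogeneous) :
    hr.quotientGraph.SetHomogeneous := by
  rintro U U' hU hU' ⟨e, -, he⟩
  have hinj : Function.Injective (Quotient.out (s := hr.orbitSetoid)) := Quotient.out_injective
  have hna : ∀ p q : Quotient hr.orbitSetoid, ¬ M.arc p.out q.out := by
    intro p q hpq
    by_cases hne : p = q
    · exact hM.1 _ (hne ▸ hpq)
    · exact hr.not_arc_of_cross (hr.cross_out hne) hpq
  let i := Equiv.Set.image Quotient.out U hinj
  let i' := Equiv.Set.image Quotient.out U' hinj
  have hi : ∀ u, ((i.symm u : Quotient hr.orbitSetoid)).out = u := fun u =>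
    congrArg Subtype.val (i.apply_symm_apply u)
  have hiso : (M.induce (Quotient.out '' U)).Iso (M.induce (Quotient.out '' U')) := by
    refine ⟨i.symm.trans (e.trans i'), ?_, fun u v => ?_⟩
    · rintro ⟨_, p, hp, rfl⟩ ⟨_, q, hq, rfl⟩
      exact iff_of_false (hna _ _) (hna _ _)
    · have := he (i.symm u) (i.symm v)
      change M.edge (i.symm u).1.out (i.symm v).1.out ↔ _ at this
      rw [hi, hi] at this
      exact this
  obtain ⟨g, hg, hgU⟩ := h _ _ (hU.image _) (hU'.image _) hiso
  have hrel : ∀ x y, hr.orbitSetoid x y ↔ hr.orbitSetoid (g x) (g y) := by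
    intro x y
    change (∃ i, y = r i x) ↔ ∃ i, g y = r i (g x)
    simp only [← hr.map_rot hg, g.injective.eq_iff]
  have hmk : ∀ p : Quotient hr.orbitSetoid,
      Quotient.congr g hrel p = Quotient.mk hr.orbitSetoid (g p.out) := by
    intro p
    conv_lhs => rw [← p.out_eq]
    rfl
  refine ⟨Quotient.congr g hrel, ⟨fun _ _ => Iff.rfl, fun p q => ?_⟩, ?_⟩
  · change M.edge p.out q.out ↔ M.edge (Quotient.out _) (Quotient.out _)
    rw [hmk, hmk, hr.edge_out_mk_iff hconst, ← hg.2]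
  · have h₁ : Quotient.mk hr.orbitSetoid '' (Quotient.out '' U') = U' := by
      simp [Set.image_image]
    rw [← h₁, ← hgU, Set.image_image, Set.image_image]
    exact Set.image_congr fun p _ => hmk p

theorem IsRotation.iso_comp_D3
    (hconst : ∀ x y i j, M.edge (r i x) (r j y) ↔ M.edge x y)
    (hM : M.IsS) : M.Iso (hr.quotientGraph.comp D3) := by
  obtain ⟨e, he, harc⟩ := hr.exists_coordinates hM (Quotient.out (s := hr.orbitSetoid))
    (by
      intro v
      obtain ⟨i, hi⟩ := Quotient.exact (Quotient.mk hr.orbitSetoid v).out_eq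
      exact ⟨_, i, hi⟩)
    (fun _ _ => hr.cross_out)
  refine ⟨e.symm, fun u v => ?_, fun u v => ?_⟩
  · obtain ⟨p, rfl⟩ := e.surjective u
    obtain ⟨q, rfl⟩ := e.surjective v
    simpa [comp, quotientGraph, D3] using harc p q
  · obtain ⟨p, rfl⟩ := e.surjective u
    obtain ⟨q, rfl⟩ := e.surjective v
    rw [e.symm_apply_apply, e.symm_apply_apply, he, he, hconst]
    simp [comp, quotientGraph, D3]

end Quotient

/-- If all pairs in different components are edges, then there are no other edges. -/
theorem SetHomogeneous.not_reach_of_edge (h : M.SetHomogeneous) (hM : M.IsS) {x y u v : V}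
    (hxy : ¬ M.Reach x y) (he : M.edge x y) (huv : M.edge u v) : ¬ M.Reach u v := by
  intro hr
  have hs := hM.2.2.2.1
  have hne : ∀ {a b}, M.edge a b → a ≠ b := by
    rintro a _ hab rfl
    exact hM.2.2.1 _ hab
  have hna := hM.2.2.2.2
  obtain ⟨g, hg, ⟨rfl, rfl⟩ | ⟨rfl, rfl⟩⟩ := h.exists_auto_pair hM (hne he) (hne huv)
    (iff_of_false (hna _ _ he) (hna _ _ huv))
    (iff_of_false (hna _ _ (hs _ _ he)) (hna _ _ (hs _ _ huv))) (iff_of_true he huv)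
  · exact hxy (hg.reach_iff.1 hr)
  · exact hxy (hg.reach_iff.1 hr).symm

theorem SetHomogeneous.iso_K_comp [Finite V] (h : M.SetHomogeneous) (hM : M.IsS)
    (hall : ∀ x y, ¬ M.Reach x y → M.edge x y) (hin : ∀ x y, M.edge x y → ¬ M.Reach x y)
    (v₀ : V) :
    M.Iso ((K (Nat.card (Quotient M.reachSetoid))).comp (M.induce {v | M.Reach v₀ v})) := by
  have hg : ∀ q : Quotient M.reachSetoid, ∃ g : V ≃ V, M.IsAuto g ∧ g q.out = v₀ :=
    fun q => h.exists_auto_apply hM _ _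
  choose g hg hgq using hg
  have hmem : ∀ v (q : Quotient M.reachSetoid),
      M.Reach v₀ (g q v) ↔ Quotient.mk M.reachSetoid v = q := by
    intro v q
    rw [← hgq q, (hg q).reach_iff]
    refine ⟨fun hv => ?_, fun hv => ?_⟩
    · rw [← q.out_eq]
      exact (Quotient.sound hv).symm
    · exact Quotient.exact (q.out_eq.trans hv.symm)
  let f : V → Fin (Nat.card (Quotient M.reachSetoid)) × {v | M.Reach v₀ v} := fun v =>
    (Finite.equivFin _ (Quotient.mk M.reachSetoid v), ⟨g (Quotient.mk M.reachSetoid v) v,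
      (hmem _ _).2 rfl⟩)
  have hf : f.Bijective := by
    constructor
    · intro u v huv
      have h₁ := (Finite.equivFin _).injective (congrArg Prod.fst huv)
      have h₂ : g (Quotient.mk M.reachSetoid u) u = g (Quotient.mk M.reachSetoid v) v :=
        congrArg Subtype.val (congrArg Prod.snd huv)
      rw [h₁] at h₂
      exact (g _).injective h₂
    · rintro ⟨n, a, ha⟩
      obtain ⟨q, rfl⟩ := (Finite.equivFin (Quotient M.reachSetoid)).surjective n
      have hq : Quotient.mk M.reachSetoid ((g q).symm a) = q := by
        rw [← hmem, Equiv.apply_symm_apply]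
        exact ha
      refine ⟨(g q).symm a, Prod.ext (congrArg (Finite.equivFin (Quotient M.reachSetoid)) hq)
        (Subtype.ext ?_)⟩
      change g (Quotient.mk M.reachSetoid _) _ = a
      rw [hq, Equiv.apply_symm_apply]
  have hfst : ∀ u v, (f u).1 = (f v).1 ↔ M.Reach u v := fun u v =>
    (Finite.equivFin _).injective.eq_iff.trans ⟨Quotient.exact, fun h => Quotient.sound h⟩
  have hsnd : ∀ u v, M.Reach u v → ((f v).2 : V) = g (Quotient.mk M.reachSetoid u) v := by
    intro u v huv
    change g (Quotient.mk M.reachSetoid v) v = _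
    rw [show Quotient.mk M.reachSetoid v = Quotient.mk M.reachSetoid u from Quotient.sound huv.symm]
  refine ⟨Equiv.ofBijective f hf, fun u v => ?_, fun u v => ?_⟩
  · change M.arc u v ↔ False ∨ ((f u).1 = (f v).1 ∧ M.arc (f u).2 (f v).2)
    rw [false_or, hfst]
    constructor
    · intro huv
      have hre := reach_of_arc huv
      refine ⟨hre, ?_⟩
      rw [hsnd u v hre]
      exact ((hg _).1 _ _).1 huv
    · rintro ⟨hre, huv⟩
      rw [hsnd u v hre] at huv
      exact ((hg _).1 _ _).2 huv
  · change M.edge u v ↔ (f u).1 ≠ (f v).1 ∨ ((f u).1 = (f v).1 ∧ M.edge (f u).2 (f v).2)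
    rw [Ne, hfst]
    constructor
    · exact fun huv => Or.inl (hin _ _ huv)
    · rintro (huv | ⟨-, huv⟩)
      · exact hall _ _ huv
      · exact (hin _ _ huv ((f u).2.2.symm.trans (f v).2.2)).elim

end Structure

/-- The case in which all pairs of vertices in different components are edges. -/
theorem SetHomogeneous.inListDisconnected_of_forall_edge {V : Type} [Finite V] {M : SDigraph V}
    (h : M.SetHomogeneous) (hM : M.IsS) {x y : V} (hxy : ¬ M.Reach x y)
    (hall : ∀ x y, ¬ M.Reach x y → M.edge x y) : InListDisconnected M := by
  have hin : ∀ u v, M.edge u v → ¬ M.Reach u v := fun u v huv =>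
    h.not_reach_of_edge hM hxy (hall x y hxy) huv
  refine Or.inl ⟨_, ?_, _, Fintype.ofFinite _, _, hM.induce _, fun u v huv => ?_,
    h.induce_reach x, h.iso_K_comp hM hall hin x⟩
  · rw [Finite.one_lt_card_iff_nontrivial]
    exact ⟨⟨Quotient.mk _ x, Quotient.mk _ y, fun hq => hxy (Quotient.exact hq)⟩⟩
  · exact hin _ _ huv (u.2.symm.trans v.2)

end SDigraph

/-- A finite set-homogeneous s-digraph which is not
Γ-connected is, up to complementation, isomorphic to `K_n[A]` (`n > 1`), to a
finite set-homogeneous graph `L`, to `L[D₃]`, or to `F₆`. -/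
theorem finite_set_homogeneous_sdigraph_not_gamma_connected
    {V : Type} [Fintype V] (M : SDigraph V) (hM : M.IsS)
    (hsh : M.SetHomogeneous) (hconn : ¬ M.GammaConnected) :
    InListDisconnected M ∨ InListDisconnected M.compl := by
  obtain ⟨x, y, hxy⟩ : ∃ x y, ¬ M.Reach x y := by
    simpa [GammaConnected, Reach] using hconn
  by_cases harc : ∃ u v, M.arc u v
  swap
  · push Not at harc
    exact Or.inl (Or.inr (Or.inl ⟨V, inferInstance, M, hM, harc, hsh,
      Or.inl ⟨Equiv.refl V, fun _ _ => Iff.rfl, fun _ _ => Iff.rfl⟩⟩))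
  by_cases hall : ∀ x y, ¬ M.Reach x y → M.edge x y
  · exact Or.inl (hsh.inListDisconnected_of_forall_edge hM hxy hall)
  have hsh' := hsh.compl hM
  have hce : ∀ u v, ¬ M.Reach u v → ¬ M.edge u v → M.compl.edge u v := fun u v huv he =>
    ⟨fun h => huv (h ▸ Reach.refl M u), he, fun h => huv (reach_of_arc h),
      fun h => huv (reach_of_arc h).symm⟩
  by_cases hnone : ∀ x y, ¬ M.Reach x y → ¬ M.edge x y
  · refine Or.inr (hsh'.inListDisconnected_of_forall_edge hM.compl (x := x) (y := y) ?_ ?_)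
    · rwa [reach_compl]
    · intro u v huv
      rw [reach_compl] at huv
      exact hce u v huv (hnone u v huv)
  push Not at hall hnone
  obtain ⟨a, b, hab, hnab⟩ := hall
  obtain ⟨c, d, hcd, hecd⟩ := hnone
  have hcomp : ∀ u v, M.Reach u v → u ≠ v → M.arc u v ∨ M.arc v u := by
    intro u v huv hne
    by_contra! hna
    have hn : ¬ M.edge u v := fun he => hsh.not_reach_of_edge hM hcd hecd he huv
    refine hsh'.not_reach_of_edge hM.compl (x := a) (y := b) (u := u) (v := v) ?_
      (hce a b hab hnab) ⟨hne, hn, hna⟩ ?_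
    · rwa [reach_compl]
    · rwa [reach_compl]
  obtain ⟨r, hr, hreach⟩ := exists_isRotation hM hsh hcomp harc
  by_cases hconst : ∀ x y i j, M.edge (r i x) (r j y) ↔ M.edge x y
  · exact Or.inl (Or.inr (Or.inl ⟨_, Fintype.ofFinite _, hr.quotientGraph,
      hr.isS_quotientGraph hM, fun _ _ => id, hr.setHomogeneous_quotientGraph hconst hM hsh,
      Or.inr (hr.iso_comp_D3 hconst hM)⟩))
  · push Not at hconst
    obtain ⟨u, v, i, j, huv⟩ := hconst
    have hcross : Cross r u v := by
      rintro k rfl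
      have h₁ : ¬ M.edge (r i u) (r j (r k u)) := fun he => by
        rw [hr.add] at he
        exact hr.not_cross_rot u i (j + k) (hr.cross_of_edge he)
      have h₂ := hr.not_edge u k
      tauto
    rcases hr.constant_or_matched hM hsh hcross with hc | hm | hm
    · have := hc i j
      tauto
    · exact Or.inl (Or.inr (Or.inr (hr.iso_F6 hM hsh hcross hm)))
    · exact Or.inr (Or.inr (Or.inr (hr.compl.iso_F6 hM.compl hsh'
        ((IsRotation.cross_neg r).2 hcross) (hr.matched_compl hcross hm))))
end
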